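/- Let 𝕂 be a number field. For every c with −1/2 < c < 0 and every α > 0: ∑_{m≥1} (b_m/m) Z_{r₁,r₂}(α/m) = (1/(2πi)) ∫_{Re s = c} (|d_𝕂|/(4^{r₂} π^{n}))^{1/2 − s} α^{−s} Γ^{r₁}((1−s)/2) Γ^{r₂}(1−s)/ζ_𝕂(s) ds. -/

import Mathlib

open Complex NumberField Filter Topology

/-- `Z_{r₁,r₂}(x)`, defined as the inverse Mellin transform
`(1/(2πi)) ∫_{Re s = c} Γ^{r₁}(s/2) Γ^{r₂}(s) x^{−s} ds` on the line `Re s = -1/4`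
(the value is independent of the choice of `c ∈ (-1/2, 0)`). -/
noncomputable def Z (r₁ r₂ : ℕ) (x : ℝ) : ℂ :=
  mellinInv (-(1/4)) (fun s => (Complex.Gamma (s / 2)) ^ r₁ * (Complex.Gamma s) ^ r₂) x

section Poisson

open MeasureTheory Real

theorem summable_pi_prod {ι : Type*} [Fintype ι] {κ : Type*} {g : ι → κ → ℝ}
    (h0 : ∀ i k, 0 ≤ g i k) (hg : ∀ i, Summable (g i)) :
    Summable fun m : ι → κ => ∏ i, g i (m i) := by
  classical
  refine summable_of_sum_le (c := ∏ i, ∑' k, g i k)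
    (fun m => Finset.prod_nonneg fun i _ => h0 i _) fun s => ?_
  let t : ι → Finset κ := fun i => s.image fun m => m i
  have hst : s ⊆ Fintype.piFinset t := fun m hm =>
    Fintype.mem_piFinset.2 fun i => Finset.mem_image_of_mem _ hm
  calc ∑ m ∈ s, ∏ i, g i (m i) ≤ ∑ m ∈ Fintype.piFinset t, ∏ i, g i (m i) :=
        Finset.sum_le_sum_of_subset_of_nonneg hst
          fun m _ _ => Finset.prod_nonneg fun i _ => h0 i _
    _ = ∏ i, ∑ k ∈ t i, g i k := (Finset.prod_univ_sum t g).symm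
    _ ≤ ∏ i, ∑' k, g i k := Finset.prod_le_prod
        (fun i _ => Finset.sum_nonneg fun k _ => h0 i k)
        fun i _ => (hg i).sum_le_tsum _ fun k _ => h0 i k

theorem summable_exp_neg_mul_int_sq {c : ℝ} (hc : 0 < c) :
    Summable fun k : ℤ => rexp (-c * (k : ℝ) ^ 2) := by
  have h := summable_pow_mul_jacobiTheta₂_term_bound 0 (T := c / π) (by positivity) 0
  refine h.congr fun k => ?_
  have : -π * (c / π * (k : ℝ) ^ 2 - 2 * 0 * |(k : ℝ)|) = -c * (k : ℝ) ^ 2 := by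
    field_simp; ring
  rw [pow_zero, one_mul, ← this]
  simp

variable {ι : Type*} [Fintype ι]

theorem summable_exp_neg_mul_sum_int_sq {c : ℝ} (hc : 0 < c) :
    Summable fun m : ι → ℤ => rexp (-c * ∑ i, (m i : ℝ) ^ 2) := by
  refine (summable_pi_prod (fun _ k => (Real.exp_pos _).le)
    (fun _ : ι => summable_exp_neg_mul_int_sq hc)).congr fun m => ?_
  rw [← Real.exp_sum, Finset.mul_sum]

/-- A bound for the translates of a function with Gaussian decay. -/
theorem norm_translate_le_of_gaussian_bound {f : (ι → ℝ) → ℂ} {C c : ℝ} (hc : 0 < c)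
    (hC : 0 ≤ C) (hf : ∀ x, ‖f x‖ ≤ C * rexp (-c * ∑ i, x i ^ 2)) {R : ℝ} {x : ι → ℝ}
    (hx : ∀ i, |x i| ≤ R) (k : ι → ℤ) :
    ‖f (fun i => x i + k i)‖ ≤
      C * rexp (c * Fintype.card ι * R ^ 2) * rexp (-(c / 2) * ∑ i, (k i : ℝ) ^ 2) := by
  refine (hf _).trans ?_
  rw [mul_assoc, ← Real.exp_add]
  refine mul_le_mul_of_nonneg_left (Real.exp_le_exp.2 ?_) hC
  have h1 : ∀ i, (k i : ℝ) ^ 2 / 2 - R ^ 2 ≤ (x i + k i) ^ 2 := fun i => by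
    have h2 : x i ^ 2 ≤ R ^ 2 := sq_le_sq' (by linarith [neg_le_of_abs_le (hx i)])
      (le_of_abs_le (hx i))
    nlinarith [sq_nonneg (2 * x i + k i)]
  have h3 := Finset.sum_le_sum fun i (_ : i ∈ Finset.univ) => h1 i
  rw [Finset.sum_sub_distrib, ← Finset.sum_div, Finset.sum_const, Finset.card_univ,
    nsmul_eq_mul] at h3
  nlinarith

theorem continuous_tsum_translate {f : C(ι → ℝ, ℂ)} {C c : ℝ} (hc : 0 < c)
    (hC : 0 ≤ C) (hf : ∀ x, ‖f x‖ ≤ C * rexp (-c * ∑ i, x i ^ 2)) :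
    Continuous fun x : ι → ℝ => ∑' k : ι → ℤ, f (fun i => x i + k i) := by
  rw [continuous_iff_continuousAt]
  intro x
  have hcont : ContinuousOn (fun x : ι → ℝ => ∑' k : ι → ℤ, f (fun i => x i + k i))
      (Metric.ball 0 (‖x‖ + 1)) := by
    refine continuousOn_tsum (fun k => by fun_prop)
      ((summable_exp_neg_mul_sum_int_sq (half_pos hc)).mul_left
        (C * rexp (c * Fintype.card ι * (‖x‖ + 1) ^ 2))) fun k y hy => ?_
    refine norm_translate_le_of_gaussian_bound hc hC hf (fun i => ?_) k
    rw [mem_ball_zero_iff] at hy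
    exact (norm_le_pi_norm y i).trans hy.le
  exact hcont.continuousAt (Metric.isOpen_ball.mem_nhds (by simp))

omit [Fintype ι] in
theorem isOpenQuotientMap_pi_coe_unitAddCircle :
    IsOpenQuotientMap (fun (x : ι → ℝ) i => (x i : UnitAddCircle)) :=
  IsOpenQuotientMap.piMap fun _ => QuotientAddGroup.isOpenQuotientMap_mk

theorem integral_eq_tsum_integral_unitCube {f : (ι → ℝ) → ℂ} (hf : Integrable f) :
    ∫ x, f x = ∑' k : ι → ℤ, ∫ x in {x : ι → ℝ | ∀ i, x i ∈ Set.Ioc ((0 : ι → ℝ) i) ((0 : ι → ℝ) i + 1)},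
      f (fun i => x i + k i) := by
  let s : (ι → ℤ) → Set (ι → ℝ) := fun k => {x | ∀ i, x i - k i ∈ Set.Ioc (0 : ℝ) 1}
  have hfloor : ∀ (x : ℝ) (k : ℤ), x - k ∈ Set.Ioc (0 : ℝ) 1 ↔ k = ⌈x⌉ - 1 := by
    intro x k
    rw [eq_sub_iff_add_eq, eq_comm, Int.ceil_eq_iff]
    push_cast
    constructor
    · rintro ⟨h1, h2⟩; constructor <;> linarith
    · rintro ⟨h1, h2⟩; constructor <;> linarith
  have hsmem : ∀ k x, x ∈ s k ↔ k = fun i => ⌈x i⌉ - 1 := fun k x => by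
    simp only [s, Set.mem_ofPred_eq, hfloor, funext_iff]
  have hmeas : ∀ k, MeasurableSet (s k) := fun k => by
    have : s k = Set.univ.pi fun i => Set.Ioc (k i : ℝ) (k i + 1) := by
      ext x
      simp only [s, Set.mem_ofPred_eq, Set.mem_pi, Set.mem_univ, true_imp_iff, Set.mem_Ioc,
        sub_pos, sub_le_iff_le_add, add_comm (1 : ℝ)]
    rw [this]
    exact MeasurableSet.univ_pi fun i => measurableSet_Ioc
  have hdisj : Pairwise (Function.onFun Disjoint s) := fun k l hkl =>
    Set.disjoint_left.2 fun x hx hx' => hkl (((hsmem k x).1 hx).trans ((hsmem l x).1 hx').symm)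
  have hU : ⋃ k, s k = Set.univ := Set.eq_univ_of_forall fun x =>
    Set.mem_iUnion.2 ⟨_, (hsmem _ x).2 rfl⟩
  rw [← setIntegral_univ, ← hU, integral_iUnion hmeas hdisj hf.integrableOn]
  refine tsum_congr fun k => ?_
  have hmp : MeasurePreserving (fun x : ι → ℝ => x + fun i => (k i : ℝ)) volume volume :=
    measurePreserving_add_right volume _
  rw [← hmp.setIntegral_preimage_emb (MeasurableEquiv.addRight _).measurableEmbedding]
  congr 2
  ext x
  simp [s]

/-- Poisson summation over `ℤ^ι` for functions with Gaussian decay. -/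
theorem hasSum_fourier_of_gaussian_bound {f : C(ι → ℝ, ℂ)} {C c : ℝ} (hc : 0 < c)
    (hC : 0 ≤ C) (hf : ∀ x, ‖f x‖ ≤ C * rexp (-c * ∑ i, x i ^ 2))
    {fhat : (ι → ℤ) → ℂ} (hfhat : Summable fhat)
    (h_int : ∀ m, ∫ x : ι → ℝ, cexp ((-2 * π * ∑ i, m i * x i : ℝ) * I) * f x = fhat m) :
    ∑' k : ι → ℤ, f (fun i => k i) = ∑' m, fhat m := by
  have hq := isOpenQuotientMap_pi_coe_unitAddCircle (ι := ι)
  let P : C(ι → ℝ, ℂ) := ⟨_, continuous_tsum_translate hc hC hf⟩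
  have hP : Function.FactorsThrough P
      (⟨_, hq.continuous⟩ : C(ι → ℝ, ι → UnitAddCircle)) := by
    intro x y hxy
    have : ∀ i, ∃ k : ℤ, x i = y i + k := fun i => by
      have h := congrFun hxy i
      obtain ⟨k, hk⟩ := (QuotientAddGroup.eq_iff_sub_mem.1 h)
      exact ⟨k, by simp at hk; linarith⟩
    choose k hk using this
    simp only [P, ContinuousMap.coe_mk]
    rw [← (Equiv.addRight k).tsum_eq fun l : ι → ℤ => f fun i => y i + l i]
    refine tsum_congr fun l => ?_
    congr 1
    ext i
    simp [hk]
    ring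
  let F : C(UnitAddTorus ι, ℂ) := hq.isQuotientMap.lift (f := ⟨_, hq.continuous⟩) P hP
  have hF : ∀ x : ι → ℝ, F (fun i => (x i : UnitAddCircle)) = ∑' k : ι → ℤ, f (fun i => x i + k i) := by
    intro x
    have := hq.isQuotientMap.lift_comp (f := ⟨_, hq.continuous⟩) P hP
    exact DFunLike.congr_fun this x
  have hdec : Integrable f := by
    have h1 : Integrable fun x : ι → ℝ => C * rexp (-c * ∑ i, x i ^ 2) := by
      refine Integrable.const_mul ?_ C
      have := Integrable.fintype_prod (f := fun (_ : ι) (x : ℝ) => rexp (-c * x ^ 2))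
        (fun _ => integrable_exp_neg_mul_sq hc)
      refine this.congr (Eventually.of_forall fun x => ?_)
      simp only [← Real.exp_sum, Finset.mul_sum]
    exact h1.mono' f.continuous.aestronglyMeasurable (Eventually.of_forall hf)
  have hcoef : ∀ m, UnitAddTorus.mFourierCoeff F m = fhat m := by
    intro m
    rw [UnitAddTorus.mFourierCoeff_eq_integral F m 0, ← h_int m]
    have hker : ∀ x : ι → ℝ, UnitAddTorus.mFourier (-m) (fun i => (x i : UnitAddCircle)) =
        cexp ((-2 * π * ∑ i, m i * x i : ℝ) * I) := by
      intro x
      simp only [UnitAddTorus.mFourier, ContinuousMap.coe_mk, fourier_coe_apply, ← Complex.exp_sum]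
      congr 1
      push_cast
      rw [Finset.mul_sum, Finset.sum_mul]
      refine Finset.sum_congr rfl fun i _ => ?_
      simp
      ring
    have hcint : Integrable fun x : ι → ℝ => cexp ((-2 * π * ∑ i, m i * x i : ℝ) * I) * f x := by
      refine hdec.bdd_mul (c := 1) (Continuous.aestronglyMeasurable (by fun_prop))
        (Eventually.of_forall fun x => ?_)
      rw [Complex.norm_exp_ofReal_mul_I]
    rw [integral_eq_tsum_integral_unitCube hcint]
    simp only [hF, hker, smul_eq_mul, ← tsum_mul_left]
    have hper : ∀ (k : ι → ℤ) (x : ι → ℝ), cexp ((-2 * π * ∑ i, m i * (x i + k i) : ℝ) * I) =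
        cexp ((-2 * π * ∑ i, m i * x i : ℝ) * I) := by
      intro k x
      rw [Complex.exp_eq_exp_iff_exists_int]
      refine ⟨-∑ i, m i * k i, ?_⟩
      simp only [mul_add, Finset.sum_add_distrib]
      push_cast
      ring
    simp only [hper]
    have hbox : volume {x : ι → ℝ | ∀ i, x i ∈ Set.Ioc ((0 : ι → ℝ) i) ((0 : ι → ℝ) i + 1)} < ⊤ ∧
        MeasurableSet {x : ι → ℝ | ∀ i, x i ∈ Set.Ioc ((0 : ι → ℝ) i) ((0 : ι → ℝ) i + 1)} := by
      have : {x : ι → ℝ | ∀ i, x i ∈ Set.Ioc ((0 : ι → ℝ) i) ((0 : ι → ℝ) i + 1)} =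
          Set.univ.pi fun i => Set.Ioc (0 : ℝ) 1 := by
        ext x; simp
      rw [this]
      exact ⟨by simp [Real.volume_pi_Ioc], MeasurableSet.univ_pi fun i => measurableSet_Ioc⟩
    have hbd : ∀ (k : ι → ℤ), ∀ x ∈ {x : ι → ℝ | ∀ i, x i ∈ Set.Ioc ((0 : ι → ℝ) i) ((0 : ι → ℝ) i + 1)},
        ‖cexp ((-2 * π * ∑ i, m i * x i : ℝ) * I) * f (fun i => x i + k i)‖ ≤
          C * rexp (c * Fintype.card ι * 1 ^ 2) * rexp (-(c / 2) * ∑ i, (k i : ℝ) ^ 2) := by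
      intro k x hx
      rw [norm_mul, Complex.norm_exp_ofReal_mul_I, one_mul]
      refine norm_translate_le_of_gaussian_bound hc hC hf (fun i => ?_) k
      have := hx i
      simp only [Pi.zero_apply, zero_add, Set.mem_Ioc] at this
      exact abs_le.2 ⟨by linarith, this.2⟩
    have hterm : ∀ k : ι → ℤ, IntegrableOn (fun x : ι → ℝ =>
        cexp ((-2 * π * ∑ i, m i * x i : ℝ) * I) * f (fun i => x i + k i))
        {x : ι → ℝ | ∀ i, x i ∈ Set.Ioc ((0 : ι → ℝ) i) ((0 : ι → ℝ) i + 1)} := fun k =>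
      Measure.integrableOn_of_bounded hbox.1.ne (Continuous.aestronglyMeasurable (by fun_prop))
        (ae_restrict_of_forall_mem hbox.2 (hbd k))
    refine (hasSum_integral_of_summable_integral_norm hterm ?_).tsum_eq.symm
    refine Summable.of_nonneg_of_le (fun k => integral_nonneg fun _ => norm_nonneg _) (fun k => ?_)
      ((((summable_exp_neg_mul_sum_int_sq (half_pos hc)).mul_left
        (C * rexp (c * Fintype.card ι * 1 ^ 2)))).mul_right
        (volume.real {x : ι → ℝ | ∀ i, x i ∈ Set.Ioc ((0 : ι → ℝ) i) ((0 : ι → ℝ) i + 1)}))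
    refine (Real.le_norm_self _).trans (norm_setIntegral_le_of_norm_le_const hbox.1 fun x hx => ?_)
    rw [norm_norm]
    exact hbd k x hx
  have hs : Summable (UnitAddTorus.mFourierCoeff F) := hfhat.congr fun m => (hcoef m).symm
  have h := UnitAddTorus.hasSum_mFourier_series_apply_of_summable hs
    (fun i => ((0 : ι → ℝ) i : UnitAddCircle))
  rw [hF] at h
  have h0 : ∀ m, UnitAddTorus.mFourier m (fun i => ((0 : ι → ℝ) i : UnitAddCircle)) = 1 := by
    simp [UnitAddTorus.mFourier]
  simp only [hcoef, h0, smul_eq_mul, mul_one] at h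
  simp only [Pi.zero_apply, zero_add] at h
  exact h.tsum_eq.symm

variable [DecidableEq ι]

theorem exists_le_sum_mulVec_sq {B : Matrix ι ι ℝ} (hB : IsUnit B.det) :
    ∃ c > 0, ∀ x : ι → ℝ, c * ∑ i, x i ^ 2 ≤ ∑ i, (B.mulVec x) i ^ 2 := by
  let S : ℝ := ∑ i, ∑ j, B⁻¹ i j ^ 2
  have hS : 0 ≤ S := Finset.sum_nonneg fun i _ => Finset.sum_nonneg fun j _ => sq_nonneg _
  refine ⟨(S + 1)⁻¹, by positivity, fun x => ?_⟩
  rw [inv_mul_le_iff₀ (by positivity)]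
  have hx : x = B⁻¹.mulVec (B.mulVec x) := by
    rw [Matrix.mulVec_mulVec, Matrix.nonsing_inv_mul _ hB, Matrix.one_mulVec]
  set y := B.mulVec x
  have h0 : 0 ≤ ∑ i, y i ^ 2 := Finset.sum_nonneg fun i _ => sq_nonneg _
  calc ∑ i, x i ^ 2 ≤ ∑ i, (∑ j, B⁻¹ i j ^ 2) * ∑ j, y j ^ 2 := by
        refine Finset.sum_le_sum fun i _ => ?_
        rw [hx]
        exact Finset.sum_mul_sq_le_sq_mul_sq _ _ _
    _ = S * ∑ j, y j ^ 2 := by rw [← Finset.sum_mul]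
    _ ≤ (S + 1) * ∑ j, y j ^ 2 := by nlinarith

theorem integral_exp_gaussian_mulVec {B : Matrix ι ι ℝ} (hB : IsUnit B.det) (w : ι → ℝ) :
    ∫ x : ι → ℝ, cexp ((-2 * π * ∑ i, w i * x i : ℝ) * I) *
        (rexp (-π * ∑ i, (B.mulVec x) i ^ 2) : ℂ) =
      (|B.det|⁻¹ * rexp (-π * ∑ i, (B⁻¹.transpose.mulVec w) i ^ 2) : ℝ) := by
  have hdet : B.det ≠ 0 := hB.ne_zero
  set u := B⁻¹.transpose.mulVec w with hu
  let g : (ι → ℝ) → ℂ := fun v => cexp (-(π : ℂ) * ∑ i, (v i : ℂ) ^ 2 +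
    ∑ i, (-2 * π * I * u i) * v i)
  have hg : ∀ x : ι → ℝ, cexp ((-2 * π * ∑ i, w i * x i : ℝ) * I) *
        (rexp (-π * ∑ i, (B.mulVec x) i ^ 2) : ℂ) = g (Matrix.toLin' B x) := by
    intro x
    have hwx : ∑ i, w i * x i = ∑ i, u i * (B.mulVec x) i := by
      change w ⬝ᵥ x = u ⬝ᵥ (B.mulVec x)
      rw [hu, Matrix.dotProduct_mulVec, Matrix.mulVec_transpose, Matrix.vecMul_vecMul,
        Matrix.nonsing_inv_mul _ hB, Matrix.vecMul_one]
    rw [hwx, Complex.ofReal_exp, ← Complex.exp_add]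
    simp only [g, Matrix.toLin'_apply]
    congr 1
    push_cast
    rw [add_comm, Finset.mul_sum, Finset.mul_sum, Finset.sum_mul]
    congr 1
    exact Finset.sum_congr rfl fun i _ => by ring
  simp only [hg]
  have hemb : MeasurableEmbedding (Matrix.toLin' B) :=
    (LinearMap.continuous_of_finiteDimensional _).measurableEmbedding fun x y hxy =>
      Matrix.mulVec_injective_of_isUnit ((Matrix.isUnit_iff_isUnit_det B).2 hB) (by simpa using hxy)
  rw [← hemb.integral_map, Real.map_matrix_volume_pi_eq_smul_volume_pi hdet, integral_smul_measure,
    GaussianFourier.integral_cexp_neg_mul_sum_add (by simpa using pi_pos)]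
  rw [ENNReal.toReal_ofReal (abs_nonneg _), abs_inv, div_self (by exact_mod_cast pi_ne_zero),
    Complex.one_cpow, one_mul]
  simp only [Complex.real_smul]
  push_cast
  congr 2
  rw [Finset.mul_sum, Finset.sum_div]
  refine Finset.sum_congr rfl fun i _ => ?_
  have : (π : ℂ) ≠ 0 := by exact_mod_cast pi_ne_zero
  field_simp
  rw [I_sq]
  ring

theorem summable_exp_gaussian_mulVec {B : Matrix ι ι ℝ} (hB : IsUnit B.det) :
    Summable fun m : ι → ℤ => rexp (-π * ∑ i, (B.mulVec fun j => (m j : ℝ)) i ^ 2) := by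
  obtain ⟨c, hc, h⟩ := exists_le_sum_mulVec_sq hB
  refine Summable.of_nonneg_of_le (fun _ => (Real.exp_pos _).le) (fun m => ?_)
    (summable_exp_neg_mul_sum_int_sq (ι := ι) (c := π * c) (by positivity))
  have := h fun j => (m j : ℝ)
  exact Real.exp_le_exp.2 (by nlinarith [pi_pos])

/-- Poisson summation for the Gaussian attached to an invertible matrix. -/
theorem tsum_exp_gaussian_mulVec {B : Matrix ι ι ℝ} (hB : IsUnit B.det) :
    ∑' m : ι → ℤ, rexp (-π * ∑ i, (B.mulVec fun j => (m j : ℝ)) i ^ 2) =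
      |B.det|⁻¹ * ∑' m : ι → ℤ, rexp (-π * ∑ i, (B⁻¹.transpose.mulVec fun j => (m j : ℝ)) i ^ 2) := by
  obtain ⟨c, hc, h⟩ := exists_le_sum_mulVec_sq hB
  let f : C(ι → ℝ, ℂ) := ⟨fun x => (rexp (-π * ∑ i, (B.mulVec x) i ^ 2) : ℂ), by
    simp only [Matrix.mulVec, dotProduct]; fun_prop⟩
  have hB' : IsUnit (B⁻¹.transpose).det := by
    rw [Matrix.det_transpose]; exact Matrix.isUnit_nonsing_inv_det _ hB
  have hf : ∀ x, ‖f x‖ ≤ 1 * rexp (-(π * c) * ∑ i, x i ^ 2) := fun x => by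
    simp only [f, ContinuousMap.coe_mk, Complex.norm_real, Real.norm_eq_abs, Real.abs_exp, one_mul]
    exact Real.exp_le_exp.2 (by nlinarith [h x, pi_pos])
  have key := hasSum_fourier_of_gaussian_bound (by positivity) zero_le_one hf
    (fhat := fun m => ((|B.det|⁻¹ *
      rexp (-π * ∑ i, (B⁻¹.transpose.mulVec fun j => (m j : ℝ)) i ^ 2) : ℝ) : ℂ))
    (Complex.ofRealCLM.summable ((summable_exp_gaussian_mulVec hB').mul_left _))
    (fun m => integral_exp_gaussian_mulVec hB _)
  rw [← tsum_mul_left]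
  apply Complex.ofReal_injective
  rw [Complex.ofReal_tsum, Complex.ofReal_tsum]
  exact key

theorem exists_mul_self_of_posDef {A : Matrix ι ι ℝ} (hA : A.PosDef) :
    ∃ B : Matrix ι ι ℝ, B.transpose = B ∧ B * B = A ∧ IsUnit B.det ∧
      ∀ x : ι → ℝ, ∑ i, (B.mulVec x) i ^ 2 = x ⬝ᵥ A.mulVec x := by
  open scoped MatrixOrder in
  have hn : 0 ≤ A := hA.posSemidef.nonneg
  have hB : CFC.sqrt A * CFC.sqrt A = A := CFC.sqrt_mul_sqrt_self A
  have hT : (CFC.sqrt A).transpose = CFC.sqrt A := by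
    have := (Matrix.nonneg_iff_posSemidef.1 (CFC.sqrt_nonneg A)).isHermitian
    rwa [Matrix.IsHermitian, Matrix.conjTranspose_eq_transpose_of_trivial] at this
  refine ⟨CFC.sqrt A, hT, hB, ?_, fun x => ?_⟩
  · rw [isUnit_iff_ne_zero]
    intro h0
    have := congrArg Matrix.det hB
    rw [Matrix.det_mul, h0, zero_mul] at this
    exact hA.det_pos.ne this
  · have : ∑ i, ((CFC.sqrt A).mulVec x) i ^ 2 = (CFC.sqrt A).mulVec x ⬝ᵥ (CFC.sqrt A).mulVec x := by
      simp [dotProduct, sq]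
    rw [this, Matrix.dotProduct_mulVec, ← Matrix.mulVec_transpose, hT, Matrix.mulVec_mulVec, hB,
      dotProduct_comm]

theorem summable_exp_gaussian_posDef {A : Matrix ι ι ℝ} (hA : A.PosDef) :
    Summable fun m : ι → ℤ =>
      rexp (-π * ((fun j => (m j : ℝ)) ⬝ᵥ A.mulVec fun j => (m j : ℝ))) := by
  obtain ⟨B, -, -, hu, hq⟩ := exists_mul_self_of_posDef hA
  simpa only [hq] using summable_exp_gaussian_mulVec hu

/-- Poisson summation for the Gaussian attached to a positive definite matrix. -/
theorem tsum_exp_gaussian_posDef {A : Matrix ι ι ℝ} (hA : A.PosDef) :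
    ∑' m : ι → ℤ, rexp (-π * ((fun j => (m j : ℝ)) ⬝ᵥ A.mulVec fun j => (m j : ℝ))) =
      (√A.det)⁻¹ * ∑' m : ι → ℤ,
        rexp (-π * ((fun j => (m j : ℝ)) ⬝ᵥ A⁻¹.mulVec fun j => (m j : ℝ))) := by
  obtain ⟨B, hT, hBA, hu, hq⟩ := exists_mul_self_of_posDef hA
  have hd : √A.det = |B.det| := by rw [← hBA, Matrix.det_mul, Real.sqrt_mul_self_eq_abs]
  have hq' : ∀ x : ι → ℝ, ∑ i, (B⁻¹.transpose.mulVec x) i ^ 2 = x ⬝ᵥ A⁻¹.mulVec x := fun x => by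
    have hT' : (B⁻¹).transpose = B⁻¹ := by rw [Matrix.transpose_nonsing_inv, hT]
    have : ∑ i, (B⁻¹.transpose.mulVec x) i ^ 2 = B⁻¹.mulVec x ⬝ᵥ B⁻¹.mulVec x := by
      simp [hT', dotProduct, sq]
    rw [this, Matrix.dotProduct_mulVec, ← Matrix.mulVec_transpose, hT', Matrix.mulVec_mulVec,
      ← Matrix.mul_inv_rev, hBA, dotProduct_comm]
  rw [hd, ← tsum_congr fun m => by rw [← hq], tsum_exp_gaussian_mulVec hu]
  simp only [hq']

end Poisson

section ThetaFunction

open Real ComplexConjugate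

variable {K : Type*} [Field K] [NumberField K]

/-- The weighted trace form `∑ w, mult w * (y w * w a) ^ 2` on a number field. -/
noncomputable def weightedForm (y : InfinitePlace K → ℝ) (a : K) : ℝ :=
  ∑ w : InfinitePlace K, w.mult * (y w * w a) ^ 2

theorem sum_comp_infinitePlace_mk (f : InfinitePlace K → ℝ) :
    ∑ φ : K →+* ℂ, f (InfinitePlace.mk φ) = ∑ w, w.mult * f w := by
  classical
  rw [← Finset.sum_fiberwise Finset.univ (fun φ : K →+* ℂ => InfinitePlace.mk φ)]
  refine Finset.sum_congr rfl fun w _ => ?_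
  rw [Finset.sum_congr rfl fun φ hφ => congrArg f (Finset.mem_filter.1 hφ).2, Finset.sum_const,
    InfinitePlace.card_filter_mk_eq, nsmul_eq_mul]

theorem prod_comp_infinitePlace_mk (f : InfinitePlace K → ℝ) :
    ∏ φ : K →+* ℂ, f (InfinitePlace.mk φ) = ∏ w, f w ^ w.mult := by
  classical
  rw [← Finset.prod_fiberwise Finset.univ (fun φ : K →+* ℂ => InfinitePlace.mk φ)]
  refine Finset.prod_congr rfl fun w _ => ?_
  rw [Finset.prod_congr rfl fun φ hφ => congrArg f (Finset.mem_filter.1 hφ).2, Finset.prod_const,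
    InfinitePlace.card_filter_mk_eq]

theorem weightedForm_eq_sum_embeddings (y : InfinitePlace K → ℝ) (a : K) :
    weightedForm y a = ∑ φ : K →+* ℂ, (y (InfinitePlace.mk φ) * ‖φ a‖) ^ 2 :=
  (sum_comp_infinitePlace_mk fun w => (y w * w a) ^ 2).symm

variable {ι : Type*} [Fintype ι] [DecidableEq ι]

/-- The Gram matrix of `weightedForm y` in the family `β`. -/
noncomputable def weightedGram (y : InfinitePlace K → ℝ) (β : ι → K) : Matrix ι ι ℝ :=
  fun i j => ∑ φ : K →+* ℂ, y (InfinitePlace.mk φ) ^ 2 * (φ (β i) * conj (φ (β j))).re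

/-- The matrix of the complex embeddings evaluated at `β`. -/
noncomputable def ringEmbeddingsMatrix (β : ι → K) (e : ι ≃ (K →+* ℂ)) : Matrix ι ι ℂ :=
  fun i k => e k (β i)

theorem map_weightedGram (y : InfinitePlace K → ℝ) (β : ι → K) (e : ι ≃ (K →+* ℂ)) :
    (weightedGram y β).map Complex.ofReal = ringEmbeddingsMatrix β e *
      Matrix.diagonal (fun k => ((y (InfinitePlace.mk (e k)) ^ 2 : ℝ) : ℂ)) *
        (ringEmbeddingsMatrix β e).conjTranspose := by
  ext i j
  rw [Matrix.mul_apply, Matrix.map_apply]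
  simp only [Matrix.mul_diagonal, Matrix.conjTranspose_apply, ringEmbeddingsMatrix, weightedGram]
  rw [e.sum_comp (fun φ : K →+* ℂ =>
    φ (β i) * ((y (InfinitePlace.mk φ) ^ 2 : ℝ) : ℂ) * star (φ (β j)))]
  set S : ℂ := ∑ φ : K →+* ℂ, φ (β i) * ((y (InfinitePlace.mk φ) ^ 2 : ℝ) : ℂ) * star (φ (β j))
    with hS
  have hc : conj S = S := by
    rw [hS, map_sum]
    refine Fintype.sum_equiv (Equiv.ofBijective _
      (ComplexEmbedding.involutive_conjugate K).bijective) _ _ fun φ => ?_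
    simp [ComplexEmbedding.conjugate_coe_eq]
  rw [← Complex.conj_eq_iff_re.1 hc, Complex.ofReal_inj, hS, Complex.re_sum]
  refine Finset.sum_congr rfl fun φ _ => ?_
  rw [mul_right_comm, mul_comm _ (((y (InfinitePlace.mk φ) ^ 2 : ℝ) : ℂ)),
    Complex.re_ofReal_mul]
  rfl

omit [DecidableEq ι] in
theorem weightedGram_form (y : InfinitePlace K → ℝ) (β : ι → K) (x : ι → ℝ) :
    x ⬝ᵥ (weightedGram y β).mulVec x =
      ∑ φ : K →+* ℂ, (y (InfinitePlace.mk φ) * ‖∑ i, (x i : ℂ) * φ (β i)‖) ^ 2 := by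
  have h (φ : K →+* ℂ) : ‖∑ i, (x i : ℂ) * φ (β i)‖ ^ 2 =
      ∑ i, ∑ j, x i * x j * (φ (β i) * conj (φ (β j))).re := by
    rw [← Complex.ofReal_re (‖_‖ ^ 2), Complex.ofReal_pow, ← Complex.mul_conj', map_sum,
      Finset.sum_mul_sum, Complex.re_sum]
    refine Finset.sum_congr rfl fun i _ => ?_
    rw [Complex.re_sum]
    refine Finset.sum_congr rfl fun j _ => ?_
    rw [map_mul, Complex.conj_ofReal, mul_mul_mul_comm, ← Complex.ofReal_mul,
      Complex.re_ofReal_mul]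
  simp_rw [mul_pow, h, dotProduct, Matrix.mulVec, dotProduct, weightedGram, Finset.mul_sum,
    Finset.sum_mul, Finset.mul_sum]
  conv_rhs => rw [Finset.sum_comm]
  refine Finset.sum_congr rfl fun i _ => ?_
  conv_rhs => rw [Finset.sum_comm]
  exact Finset.sum_congr rfl fun j _ => Finset.sum_congr rfl fun φ _ => by ring

/-- The embeddings matrix is invertible for a `ℚ`-basis. -/
theorem det_ringEmbeddingsMatrix_sq (β : Module.Basis ι ℚ K) (e : ι ≃ (K →+* ℂ)) :
    (ringEmbeddingsMatrix β e).det ^ 2 = ((Algebra.discr ℚ β : ℚ) : ℂ) := by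
  have := Algebra.discr_eq_det_embeddingsMatrixReindex_pow_two ℚ ℂ β
    (e.trans (RingHom.equivRatAlgHom K ℂ))
  rw [eq_ratCast] at this
  rw [this]
  congr 2

theorem weightedGram_det (y : InfinitePlace K → ℝ) (β : Module.Basis ι ℚ K) :
    (weightedGram y β).det = (∏ w, y w ^ w.mult) ^ 2 * |((Algebra.discr ℚ β : ℚ) : ℝ)| := by
  have e : ι ≃ (K →+* ℂ) := Fintype.equivOfCardEq (by
    rw [NumberField.Embeddings.card, Module.finrank_eq_card_basis β])
  have h1 : ((weightedGram y β).det : ℂ) = ((weightedGram y β).map Complex.ofReal).det :=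
    RingHom.map_det Complex.ofRealHom _
  apply Complex.ofReal_injective
  rw [h1, map_weightedGram y β e, Matrix.det_mul, Matrix.det_mul, Matrix.det_diagonal,
    Matrix.det_conjTranspose, mul_right_comm]
  have h2 : (ringEmbeddingsMatrix β e).det * star (ringEmbeddingsMatrix β e).det =
      ((|((Algebra.discr ℚ β : ℚ) : ℝ)| : ℝ) : ℂ) := by
    have h3 := congrArg norm (det_ringEmbeddingsMatrix_sq β e)
    rw [norm_pow] at h3
    erw [Complex.mul_conj', ← Complex.ofReal_pow, h3]
    rw [← Complex.ofReal_ratCast, Complex.norm_real, Real.norm_eq_abs]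
  rw [h2, ← Complex.ofReal_prod, ← Complex.ofReal_mul, mul_comm, Finset.prod_pow,
    e.prod_comp (fun φ => y (InfinitePlace.mk φ)), prod_comp_infinitePlace_mk]

omit [Fintype ι] [DecidableEq ι] in
theorem weightedGram_isHermitian (y : InfinitePlace K → ℝ) (β : ι → K) :
    (weightedGram y β).IsHermitian := by
  ext i j
  simp only [Matrix.conjTranspose_apply, weightedGram, star_trivial]
  refine Finset.sum_congr rfl fun φ _ => ?_
  rw [← Complex.conj_re (φ (β j) * _), map_mul, Complex.conj_conj, mul_comm (φ (β i))]

theorem weightedGram_posDef {y : InfinitePlace K → ℝ} (hy : ∀ w, 0 < y w)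
    (β : Module.Basis ι ℚ K) : (weightedGram y β).PosDef := by
  have e : ι ≃ (K →+* ℂ) := Fintype.equivOfCardEq (by
    rw [NumberField.Embeddings.card, Module.finrank_eq_card_basis β])
  refine Matrix.PosDef.of_dotProduct_mulVec_pos (weightedGram_isHermitian y β) fun x hx => ?_
  rw [star_trivial, weightedGram_form]
  by_contra! h
  have h0 := (Finset.sum_eq_zero_iff_of_nonneg fun φ _ => sq_nonneg _).1
    (le_antisymm h (Finset.sum_nonneg fun φ _ => sq_nonneg _))
  have hv : (ringEmbeddingsMatrix β e).vecMul (fun i => (x i : ℂ)) = 0 := by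
    ext k
    have := h0 (e k) (Finset.mem_univ _)
    rw [sq_eq_zero_iff, mul_eq_zero, or_iff_right (hy _).ne', norm_eq_zero] at this
    exact this
  have hd : (ringEmbeddingsMatrix β e).det ≠ 0 := by
    intro hd
    have := det_ringEmbeddingsMatrix_sq β e
    rw [hd, zero_pow two_ne_zero, eq_comm, Rat.cast_eq_zero] at this
    exact Algebra.discr_not_zero_of_basis ℚ β this
  have := Matrix.eq_zero_of_vecMul_eq_zero hd hv
  exact hx (funext fun i => Complex.ofReal_eq_zero.1 (congrFun this i))

theorem sum_embeddings_basis_mul_traceDual (β : Module.Basis ι ℚ K) (i j : ι) :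
    ∑ φ : K →+* ℂ, φ (β i) * φ (β.traceDual j) = if i = j then 1 else 0 := by
  have h1 := trace_eq_sum_embeddings (K := ℚ) ℂ (x := β i * β.traceDual j)
  have h2 := β.trace_mul_traceDual i j
  rw [h2] at h1
  rw [Fintype.sum_equiv (RingHom.equivRatAlgHom K ℂ) (fun φ => φ (β i) * φ (β.traceDual j))
    (fun φ => φ (β i * β.traceDual j)) fun φ => by simp [RingHom.equivRatAlgHom_apply], ← h1]
  split_ifs <;> simp

theorem ringEmbeddingsMatrix_mul_traceDual (β : Module.Basis ι ℚ K) (e : ι ≃ (K →+* ℂ)) :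
    ringEmbeddingsMatrix β e * (ringEmbeddingsMatrix β.traceDual e).transpose = 1 := by
  ext i j
  rw [Matrix.mul_apply, Matrix.one_apply, ← sum_embeddings_basis_mul_traceDual β,
    ← e.sum_comp]
  rfl

theorem weightedGram_inv {y : InfinitePlace K → ℝ} (hy : ∀ w, 0 < y w)
    (β : Module.Basis ι ℚ K) :
    (weightedGram y β)⁻¹ = weightedGram (fun w => (y w)⁻¹) β.traceDual := by
  have e : ι ≃ (K →+* ℂ) := Fintype.equivOfCardEq (by
    rw [NumberField.Embeddings.card, Module.finrank_eq_card_basis β])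
  apply Matrix.inv_eq_right_inv
  apply Matrix.map_injective Complex.ofReal_injective
  have h1 : (weightedGram (fun w => (y w)⁻¹) β.traceDual).map Complex.ofReal =
      (ringEmbeddingsMatrix β.traceDual e).map conj *
      Matrix.diagonal (fun k => ((((y (InfinitePlace.mk (e k)))⁻¹) ^ 2 : ℝ) : ℂ)) *
        (ringEmbeddingsMatrix β.traceDual e).transpose := by
    have := congrArg (fun A : Matrix ι ι ℂ => A.map conj)
      (map_weightedGram (fun w => (y w)⁻¹) β.traceDual e)
    simp only [Matrix.map_map, Matrix.map_mul] at this
    convert this using 2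
    · ext; simp
    · congr 1
      rw [Matrix.diagonal_map (map_zero _)]
      congr 1
      ext k
      simp
    · ext; simp
  have h2 := ringEmbeddingsMatrix_mul_traceDual β e
  have h3 : (ringEmbeddingsMatrix β e).conjTranspose * (ringEmbeddingsMatrix β.traceDual e).map conj
      = 1 := by
    have h4 := congrArg Matrix.conjTranspose (mul_eq_one_comm.1 h2)
    rwa [Matrix.conjTranspose_mul, Matrix.conjTranspose_one] at h4
  have h5 : Matrix.diagonal (fun k => ((y (InfinitePlace.mk (e k)) ^ 2 : ℝ) : ℂ)) *
      Matrix.diagonal (fun k => ((((y (InfinitePlace.mk (e k)))⁻¹) ^ 2 : ℝ) : ℂ)) = 1 := by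
    rw [Matrix.diagonal_mul_diagonal, ← Matrix.diagonal_one]
    congr 1
    ext k
    rw [← Complex.ofReal_mul, ← mul_pow, mul_inv_cancel₀ (hy _).ne', one_pow, Complex.ofReal_one]
  have h6 : (weightedGram y β * weightedGram (fun w => (y w)⁻¹) β.traceDual).map Complex.ofReal =
      (weightedGram y β).map Complex.ofReal *
        (weightedGram (fun w => (y w)⁻¹) β.traceDual).map Complex.ofReal :=
    Matrix.map_mul (f := Complex.ofRealHom)
  show (weightedGram y β * weightedGram (fun w => (y w)⁻¹) β.traceDual).map Complex.ofReal =
    (1 : Matrix ι ι ℝ).map Complex.ofReal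
  rw [h6, h1, map_weightedGram y β e, Matrix.map_one _ Complex.ofReal_zero Complex.ofReal_one]
  simp only [Matrix.mul_assoc]
  rw [← Matrix.mul_assoc _ ((ringEmbeddingsMatrix β.traceDual e).map conj), h3, Matrix.one_mul,
    ← Matrix.mul_assoc (Matrix.diagonal _) (Matrix.diagonal _), h5, Matrix.one_mul, h2]

omit [DecidableEq ι] in
theorem weightedForm_basis (y : InfinitePlace K → ℝ) (β : Module.Basis ι ℚ K) (m : ι → ℤ) :
    (fun j => (m j : ℝ)) ⬝ᵥ (weightedGram y β).mulVec (fun j => (m j : ℝ)) =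
      weightedForm y (∑ i, m i • β i) := by
  rw [weightedGram_form, weightedForm_eq_sum_embeddings]
  refine Finset.sum_congr rfl fun φ _ => ?_
  simp

theorem summable_exp_weightedForm_basis {y : InfinitePlace K → ℝ} (hy : ∀ w, 0 < y w)
    (β : Module.Basis ι ℚ K) :
    Summable fun m : ι → ℤ => rexp (-π * weightedForm y (∑ i, m i • β i)) := by
  simpa only [weightedForm_basis] using summable_exp_gaussian_posDef (weightedGram_posDef hy β)

theorem tsum_exp_weightedForm_basis {y : InfinitePlace K → ℝ} (hy : ∀ w, 0 < y w)
    (β : Module.Basis ι ℚ K) :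
    ∑' m : ι → ℤ, rexp (-π * weightedForm y (∑ i, m i • β i)) =
      (√|((Algebra.discr ℚ β : ℚ) : ℝ)|)⁻¹ * (∏ w, y w ^ w.mult)⁻¹ *
        ∑' m : ι → ℤ, rexp (-π * weightedForm (fun w => (y w)⁻¹) (∑ i, m i • β.traceDual i)) := by
  have h := tsum_exp_gaussian_posDef (weightedGram_posDef hy β)
  rw [weightedGram_inv hy, weightedGram_det, Real.sqrt_mul (sq_nonneg _), Real.sqrt_sq
    (Finset.prod_nonneg fun w _ => pow_nonneg (hy w).le _)] at h
  simp only [weightedForm_basis] at h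
  rw [h, mul_inv, mul_comm (∏ w, y w ^ w.mult)⁻¹]

end ThetaFunction

section FractionalIdealTheta

open Real
open scoped nonZeroDivisors

variable {K : Type*} [Field K] [NumberField K]

/-- Coordinates of the members of a predicate describing the `ℤ`-span of a basis. -/
noncomputable def equivOfMemSpanBasis {ι : Type*} [Finite ι] (β : Module.Basis ι ℚ K)
    {P : K → Prop} (hP : ∀ x, P x ↔ x ∈ Submodule.span ℤ (Set.range β)) :
    (ι → ℤ) ≃ {a : K // P a} :=
  (β.restrictScalars ℤ).equivFun.symm.toEquiv.trans
    (Equiv.subtypeEquivRight fun x => (hP x).symm)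

theorem coe_equivOfMemSpanBasis {ι : Type*} [Fintype ι] (β : Module.Basis ι ℚ K)
    {P : K → Prop} (hP : ∀ x, P x ↔ x ∈ Submodule.span ℤ (Set.range β)) (m : ι → ℤ) :
    (equivOfMemSpanBasis β hP m : K) = ∑ i, m i • β i := by
  simp [equivOfMemSpanBasis, Module.Basis.equivFun_symm_apply]

theorem discr_basisOfFractionalIdeal (J : (FractionalIdeal (𝓞 K)⁰ K)ˣ) :
    Algebra.discr ℚ (basisOfFractionalIdeal K J) =
      FractionalIdeal.absNorm (J : FractionalIdeal (𝓞 K)⁰ K) ^ 2 * discr K := by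
  have e : (Module.Free.ChooseBasisIndex ℤ (𝓞 K)) ≃ (Module.Free.ChooseBasisIndex ℤ J) :=
    Fintype.equivOfCardEq (by
      rw [← Module.finrank_eq_card_chooseBasisIndex, ← Module.finrank_eq_card_chooseBasisIndex,
        fractionalIdeal_rank])
  rw [← det_basisOfFractionalIdeal_eq_absNorm K J e, sq_abs, coe_discr]
  have h := Algebra.discr_of_matrix_vecMul (A := ℚ) (integralBasis K)
    ((integralBasis K).toMatrix ((basisOfFractionalIdeal K J).reindex e.symm))
  rw [Module.Basis.det_apply, ← h]
  rw [← Algebra.discr_reindex ℚ (basisOfFractionalIdeal K J) e.symm]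
  congr 1
  have := (integralBasis K).toMatrix_map_vecMul ((basisOfFractionalIdeal K J).reindex e.symm)
  rw [this, Module.Basis.coe_reindex]

/-- The dual of a fractional ideal with respect to the trace form. -/
noncomputable def traceDualUnit (J : (FractionalIdeal (𝓞 K)⁰ K)ˣ) :
    (FractionalIdeal (𝓞 K)⁰ K)ˣ :=
  Units.mk0 (FractionalIdeal.dual ℤ ℚ (J : FractionalIdeal (𝓞 K)⁰ K))
    (FractionalIdeal.dual_ne_zero ℤ ℚ J.ne_zero)

theorem traceDualUnit_eq (J : (FractionalIdeal (𝓞 K)⁰ K)ˣ) :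
    traceDualUnit J = traceDualUnit 1 * J⁻¹ := by
  apply Units.ext
  simp [traceDualUnit, FractionalIdeal.dual_eq_mul_inv ℤ ℚ (I := (J : FractionalIdeal (𝓞 K)⁰ K))]

theorem absNorm_traceDualUnit (J : (FractionalIdeal (𝓞 K)⁰ K)ˣ) :
    FractionalIdeal.absNorm (traceDualUnit J : FractionalIdeal (𝓞 K)⁰ K) =
      (FractionalIdeal.absNorm (J : FractionalIdeal (𝓞 K)⁰ K))⁻¹ * (|(discr K : ℚ)|)⁻¹ := by
  have h := coeIdeal_differentIdeal ℤ ℚ K (𝓞 K)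
  have h2 := congrArg FractionalIdeal.absNorm h
  rw [FractionalIdeal.coeIdeal_absNorm, absNorm_differentIdeal K, map_inv₀] at h2
  simp only [traceDualUnit, Units.val_mk0]
  rw [FractionalIdeal.dual_eq_mul_inv, map_mul, map_inv₀, mul_comm, ← inv_inv
    (FractionalIdeal.absNorm (FractionalIdeal.dual ℤ ℚ 1)), ← h2, Nat.cast_natAbs, Int.cast_abs]

theorem mem_units_fractionalIdeal_iff (J : (FractionalIdeal (𝓞 K)⁰ K)ˣ) (x : K) :
    x ∈ (J : FractionalIdeal (𝓞 K)⁰ K) ↔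
      x ∈ Submodule.span ℤ (Set.range (basisOfFractionalIdeal K J)) := by
  rw [mem_span_basisOfFractionalIdeal]
  rfl

open scoped Classical in
theorem mem_traceDualUnit (J : (FractionalIdeal (𝓞 K)⁰ K)ˣ) (x : K) :
    x ∈ (traceDualUnit J : FractionalIdeal (𝓞 K)⁰ K) ↔
      x ∈ Submodule.span ℤ (Set.range (basisOfFractionalIdeal K J).traceDual) := by
  have h := Submodule.traceDual_span_of_basis ℤ
    ((J : FractionalIdeal (𝓞 K)⁰ K) : Submodule (𝓞 K) K) (basisOfFractionalIdeal K J) (by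
      ext x
      exact mem_units_fractionalIdeal_iff J x)
  rw [← h, Submodule.restrictScalars_mem, ← FractionalIdeal.coe_dual ℤ ℚ J.ne_zero]
  rfl

theorem summable_exp_weightedForm {y : InfinitePlace K → ℝ} (hy : ∀ w, 0 < y w)
    (J : (FractionalIdeal (𝓞 K)⁰ K)ˣ) :
    Summable fun a : {a : K // a ∈ (J : FractionalIdeal (𝓞 K)⁰ K)} =>
      rexp (-π * weightedForm y a) := by
  classical
  rw [← (equivOfMemSpanBasis _ (mem_units_fractionalIdeal_iff J)).summable_iff]
  refine (summable_exp_weightedForm_basis hy (basisOfFractionalIdeal K J)).congr fun m => ?_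
  rw [Function.comp_apply, coe_equivOfMemSpanBasis]

/-- The functional equation of the theta function of a fractional ideal. -/
theorem tsum_exp_weightedForm {y : InfinitePlace K → ℝ} (hy : ∀ w, 0 < y w)
    (J : (FractionalIdeal (𝓞 K)⁰ K)ˣ) :
    ∑' a : {a : K // a ∈ (J : FractionalIdeal (𝓞 K)⁰ K)}, rexp (-π * weightedForm y a) =
      (√|(discr K : ℝ)| * (FractionalIdeal.absNorm (J : FractionalIdeal (𝓞 K)⁰ K) : ℚ))⁻¹ *
        (∏ w, y w ^ w.mult)⁻¹ *
      ∑' a : {a : K // a ∈ (traceDualUnit J : FractionalIdeal (𝓞 K)⁰ K)},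
        rexp (-π * weightedForm (fun w => (y w)⁻¹) a) := by
  classical
  rw [← (equivOfMemSpanBasis _ (mem_units_fractionalIdeal_iff J)).tsum_eq,
    ← (equivOfMemSpanBasis _ (mem_traceDualUnit J)).tsum_eq]
  simp_rw [coe_equivOfMemSpanBasis]
  rw [tsum_exp_weightedForm_basis hy, discr_basisOfFractionalIdeal]
  congr 3
  rw [Rat.cast_mul, Rat.cast_pow, abs_mul, abs_pow, sq_abs, mul_comm, Rat.cast_intCast,
    Real.sqrt_mul (abs_nonneg _), Real.sqrt_sq]
  exact_mod_cast FractionalIdeal.absNorm_nonneg _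

end FractionalIdealTheta

section UnitUnfolding

open Real MeasureTheory NumberField.Units NumberField.Units.dirichletUnitTheorem
open scoped nonZeroDivisors Classical

variable {K : Type*} [Field K] [NumberField K]

/-- The vector indexed by all infinite places whose entries away from `w₀` are those of `u` and
whose entries sum to `log x`. -/
noncomputable def logCoord (x : ℝ) (u : logSpace K) (w : InfinitePlace K) : ℝ :=
  if h : w = w₀ then Real.log x - ∑ i, u i else u ⟨w, h⟩

/-- The positive weights with product `x` attached to a point of the logarithmic space. -/
noncomputable def logWeight (x : ℝ) (u : logSpace K) (w : InfinitePlace K) : ℝ :=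
  rexp (logCoord x u w / w.mult)

theorem logWeight_pos (x : ℝ) (u : logSpace K) (w : InfinitePlace K) : 0 < logWeight x u w :=
  Real.exp_pos _

omit [NumberField K] in
theorem mult_pos_real (w : InfinitePlace K) : (0 : ℝ) < w.mult := by
  exact_mod_cast w.mult_pos

theorem sum_eq_add_sum_subtype_ne {M : Type*} [AddCommMonoid M] (f : InfinitePlace K → M) :
    ∑ w, f w = f w₀ + ∑ i : {w : InfinitePlace K // w ≠ w₀}, f i := by
  rw [← Finset.add_sum_erase Finset.univ f (Finset.mem_univ w₀)]
  congr 1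
  exact Finset.sum_subtype _ (by simp) f

theorem prod_eq_mul_prod_subtype_ne {M : Type*} [CommMonoid M] (f : InfinitePlace K → M) :
    ∏ w, f w = f w₀ * ∏ i : {w : InfinitePlace K // w ≠ w₀}, f i := by
  rw [← Finset.mul_prod_erase Finset.univ f (Finset.mem_univ w₀)]
  congr 1
  exact Finset.prod_subtype _ (by simp) f

theorem logCoord_w₀ (x : ℝ) (u : logSpace K) :
    logCoord x u w₀ = Real.log x - ∑ i, u i := dif_pos rfl

theorem logCoord_ne (x : ℝ) (u : logSpace K) (i : {w : InfinitePlace K // w ≠ w₀}) :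
    logCoord x u i = u i := dif_neg i.2

theorem sum_logCoord (x : ℝ) (u : logSpace K) : ∑ w, logCoord x u w = Real.log x := by
  simp [sum_eq_add_sum_subtype_ne, logCoord_w₀, logCoord_ne]

theorem prod_logWeight {x : ℝ} (hx : 0 < x) (u : logSpace K) :
    ∏ w, logWeight x u w ^ w.mult = x := by
  have (w : InfinitePlace K) : logWeight x u w ^ w.mult = rexp (logCoord x u w) := by
    rw [logWeight, ← Real.exp_nat_mul, mul_div_cancel₀ _ (mult_pos_real w).ne']
  rw [Finset.prod_congr rfl fun w _ => this w, ← Real.exp_sum, sum_logCoord, Real.exp_log hx]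

theorem logCoord_inv (x : ℝ) (u : logSpace K) (w : InfinitePlace K) :
    logCoord x⁻¹ (-u) w = -logCoord x u w := by
  rw [logCoord, logCoord]
  split_ifs with h
  · simp [Real.log_inv]; ring
  · simp

theorem inv_logWeight (x : ℝ) (u : logSpace K) :
    (fun w => (logWeight x u w)⁻¹) = logWeight x⁻¹ (-u) := by
  ext w
  rw [logWeight, logWeight, logCoord_inv, neg_div, Real.exp_neg]

theorem logCoord_add_logEmbedding (x : ℝ) (u : logSpace K) (ε : (𝓞 K)ˣ) (w : InfinitePlace K) :
    logCoord x (u + logEmbedding K (Additive.ofMul ε)) w =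
      logCoord x u w + w.mult * Real.log (w (ε : K)) := by
  rw [logCoord, logCoord]
  split_ifs with h
  · subst h
    simp only [Pi.add_apply, Finset.sum_add_distrib, sum_logEmbedding_component]
    ring
  · rw [Pi.add_apply, logEmbedding_component]

theorem weightedForm_unit_mul (x : ℝ) (u : logSpace K) (ε : (𝓞 K)ˣ) (a : K) :
    weightedForm (logWeight x u) ((ε : K) * a) =
      weightedForm (logWeight x (u + logEmbedding K (Additive.ofMul ε))) a := by
  refine Finset.sum_congr rfl fun w _ => ?_
  have h0 : 0 < w (ε : K) := w.pos_iff.2 (Units.coe_ne_zero ε)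
  rw [logWeight, logWeight, logCoord_add_logEmbedding, add_div,
    mul_div_cancel_left₀ _ (mult_pos_real w).ne', Real.exp_add, Real.exp_log h0, map_mul, mul_assoc]

theorem logWeight_mono {x x' : ℝ} (hx : 0 < x) (h : x ≤ x') (u : logSpace K)
    (w : InfinitePlace K) : logWeight x u w ≤ logWeight x' u w := by
  unfold logWeight
  gcongr
  unfold logCoord
  split_ifs
  · gcongr
  · rfl

theorem weightedForm_mono {y y' : InfinitePlace K → ℝ} (hy : ∀ w, 0 ≤ y w) (h : ∀ w, y w ≤ y' w)
    (a : K) : weightedForm y a ≤ weightedForm y' a := by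
  unfold weightedForm
  gcongr with w
  · exact mul_nonneg (hy w) (apply_nonneg w a)
  · exact h w

theorem measurable_weightedForm_logWeight (a : K) :
    Measurable fun p : ℝ × logSpace K => weightedForm (logWeight p.1 p.2) a := by
  unfold weightedForm logWeight logCoord
  refine Finset.measurable_sum _ fun w _ => ?_
  split_ifs with h <;> fun_prop

end UnitUnfolding

section ArchimedeanIntegral

open Real MeasureTheory NumberField.Units NumberField.Units.dirichletUnitTheorem
open scoped nonZeroDivisors Classical

theorem lintegral_Ioi_zero_eq_lintegral_exp (g : ℝ → ENNReal) :
    ∫⁻ x in Set.Ioi 0, g x = ∫⁻ t, ENNReal.ofReal (rexp t) * g (rexp t) := by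
  have := lintegral_image_eq_lintegral_abs_deriv_mul MeasurableSet.univ
    (fun x _ => (Real.hasDerivAt_exp x).hasDerivWithinAt) Real.exp_injective.injOn g
  rwa [Set.image_univ, Real.range_exp, Measure.restrict_univ, funext fun x =>
    congrArg (fun y => ENNReal.ofReal y * g (rexp x)) (abs_of_pos (Real.exp_pos x))] at this

/-- The local factor whose product over the infinite places is integrated in the method of Hecke. -/
noncomputable def archKernel (s : ℝ) (m : ℕ) (r v : ℝ) : ℝ :=
  rexp (s * v) * rexp (-π * (m * (rexp (v / m) * r) ^ 2))

theorem archKernel_nonneg (s : ℝ) (m : ℕ) (r v : ℝ) : 0 ≤ archKernel s m r v := by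
  unfold archKernel; positivity

theorem continuous_archKernel (s : ℝ) (m : ℕ) (r : ℝ) : Continuous (archKernel s m r) := by
  unfold archKernel; fun_prop

/-- The value of the integral of `archKernel`. -/
noncomputable def archFactor (s : ℝ) (m : ℕ) : ℝ :=
  (π * m) ^ (-(m * s / 2)) * (m / 2) * Real.Gamma (m * s / 2)

theorem archFactor_pos {s : ℝ} (hs : 0 < s) {m : ℕ} (hm : 0 < m) : 0 < archFactor s m := by
  have hm' : (0 : ℝ) < m := by exact_mod_cast hm
  have : 0 < Real.Gamma (m * s / 2) := Real.Gamma_pos_of_pos (by positivity)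
  unfold archFactor
  positivity

theorem lintegral_archKernel {s : ℝ} (hs : 0 < s) {m : ℕ} (hm : 0 < m) {r : ℝ} (hr : 0 < r) :
    ∫⁻ v, ENNReal.ofReal (archKernel s m r v) =
      ENNReal.ofReal ((r ^ m) ^ (-s) * archFactor s m) := by
  have hm' : (0 : ℝ) < m := by exact_mod_cast hm
  have hp : (0 : ℝ) < 2 / m := by positivity
  have hb : 0 < π * m * r ^ 2 := by positivity
  have h1 := integral_rpow_mul_exp_neg_mul_rpow hp (q := s - 1) (by linarith) hb
  have h2 : ∫⁻ x in Set.Ioi (0 : ℝ),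
      ENNReal.ofReal (x ^ (s - 1) * rexp (-(π * m * r ^ 2) * x ^ (2 / (m : ℝ)))) =
      ∫⁻ v, ENNReal.ofReal (archKernel s m r v) := by
    rw [lintegral_Ioi_zero_eq_lintegral_exp]
    refine lintegral_congr fun v => ?_
    rw [← ENNReal.ofReal_mul (Real.exp_pos _).le, ← mul_assoc, ← Real.exp_mul, ← Real.exp_add,
      ← Real.exp_mul, archKernel, mul_pow, ← Real.exp_nat_mul]
    congr 3
    · ring
    · rw [show v * (2 / (m : ℝ)) = ((2 : ℕ) : ℝ) * (v / m) by push_cast; ring]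
      ring
  rw [← h2, ← ofReal_integral_eq_lintegral_ofReal, h1]
  · congr 1
    have e1 : -(s - 1 + 1) / (2 / (m : ℝ)) = -(m * s / 2) := by field_simp; ring
    have e2 : (s - 1 + 1) / (2 / (m : ℝ)) = m * s / 2 := by field_simp; ring
    rw [e1, e2, archFactor, Real.mul_rpow (by positivity) (by positivity), ← Real.rpow_natCast r 2,
      ← Real.rpow_mul hr.le, ← Real.rpow_natCast r m, ← Real.rpow_mul hr.le]
    have e3 : ((2 : ℕ) : ℝ) * -(m * s / 2) = m * -s := by push_cast; ring
    rw [e3]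
    field_simp
  · by_contra h
    rw [integral_undef h] at h1
    have : 0 < (π * m * r ^ 2) ^ (-(s - 1 + 1) / (2 / (m : ℝ))) * (1 / (2 / (m : ℝ))) *
        Real.Gamma ((s - 1 + 1) / (2 / (m : ℝ))) := by
      have : 0 < Real.Gamma ((s - 1 + 1) / (2 / (m : ℝ))) := Real.Gamma_pos_of_pos (by
        rw [sub_add_cancel]; positivity)
      positivity
    exact this.ne h1
  · filter_upwards [ae_restrict_mem measurableSet_Ioi] with x hx
    have : (0 : ℝ) < x := hx
    simp only [Pi.zero_apply]
    positivity

theorem integrable_archKernel {s : ℝ} (hs : 0 < s) {m : ℕ} (hm : 0 < m) {r : ℝ} (hr : 0 < r) :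
    Integrable (archKernel s m r) := by
  refine ⟨(continuous_archKernel s m r).aestronglyMeasurable, ?_⟩
  rw [hasFiniteIntegral_iff_ofReal (ae_of_all _ fun v => archKernel_nonneg s m r v),
    lintegral_archKernel hs hm hr]
  exact ENNReal.ofReal_lt_top

theorem lintegral_fintype_prod_ofReal {ι : Type*} [Fintype ι] {f : ι → ℝ → ℝ}
    (hf : ∀ i, Integrable (f i)) (h0 : ∀ i x, 0 ≤ f i x) :
    ∫⁻ u : ι → ℝ, ENNReal.ofReal (∏ i, f i (u i)) = ∏ i, ∫⁻ v, ENNReal.ofReal (f i v) := by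
  rw [volume_pi, ← ofReal_integral_eq_lintegral_ofReal (Integrable.fintype_prod hf)
    (ae_of_all _ fun u => Finset.prod_nonneg fun i _ => h0 i _), integral_fintype_prod_eq_prod,
    ENNReal.ofReal_prod_of_nonneg fun i _ => integral_nonneg fun x => h0 i x]
  exact Finset.prod_congr rfl fun i _ =>
    ofReal_integral_eq_lintegral_ofReal (hf i) (ae_of_all _ fun x => h0 i x)

variable {K : Type*} [Field K] [NumberField K]

theorem lintegral_lintegral_exp_weightedForm {s : ℝ} (hs : 0 < s) {a : K} (ha : a ≠ 0) :
    ∫⁻ x in Set.Ioi (0 : ℝ), ENNReal.ofReal (x ^ (s - 1)) * ∫⁻ u : logSpace K,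
        ENNReal.ofReal (rexp (-π * weightedForm (logWeight x u) a)) =
      ENNReal.ofReal (|(Algebra.norm ℚ a : ℝ)| ^ (-s) *
        ∏ w : InfinitePlace K, archFactor s w.mult) := by
  have hm (b : K) := measurable_weightedForm_logWeight b
  have hm2 : Measurable fun p : ℝ × logSpace K => ENNReal.ofReal
      (rexp (s * p.1) * rexp (-π * weightedForm (logWeight (rexp p.1) p.2) a)) := by
    have := (hm a).comp (g := fun p : ℝ × logSpace K => weightedForm (logWeight p.1 p.2) a)
      (f := fun p : ℝ × logSpace K => (rexp p.1, p.2)) (by fun_prop)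
    refine ENNReal.measurable_ofReal.comp ?_
    exact (by fun_prop : Measurable fun p : ℝ × logSpace K => rexp (s * p.1)).mul
      (Real.measurable_exp.comp (this.const_mul _))
  have key (u : logSpace K) (t : ℝ) :
      rexp (s * (t + ∑ i, u i)) * rexp (-π * weightedForm (logWeight (rexp (t + ∑ i, u i)) u) a) =
        archKernel s (w₀ : InfinitePlace K).mult (w₀ a) t *
          ∏ i : {w : InfinitePlace K // w ≠ w₀}, archKernel s i.1.mult (i.1 a) (u i) := by
    have h := prod_eq_mul_prod_subtype_ne (K := K) fun w =>
      archKernel s w.mult (w a) (logCoord (rexp (t + ∑ i, u i)) u w)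
    rw [logCoord_w₀, Real.log_exp, add_sub_cancel_right] at h
    simp only [logCoord_ne] at h
    rw [← h]
    unfold archKernel
    rw [Finset.prod_mul_distrib, ← Real.exp_sum, ← Real.exp_sum, ← Finset.mul_sum, sum_logCoord,
      Real.log_exp, ← Finset.mul_sum]
    rfl
  calc _ = ∫⁻ t, ∫⁻ u : logSpace K, ENNReal.ofReal
        (rexp (s * t) * rexp (-π * weightedForm (logWeight (rexp t) u) a)) := by
        rw [lintegral_Ioi_zero_eq_lintegral_exp]
        refine lintegral_congr fun t => ?_
        rw [← mul_assoc, ← ENNReal.ofReal_mul (Real.exp_pos _).le, ← lintegral_const_mul']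
        · refine lintegral_congr fun u => ?_
          rw [← ENNReal.ofReal_mul (by positivity), ← Real.exp_mul, ← Real.exp_add]
          congr 3
          ring
        · exact ENNReal.ofReal_ne_top
    _ = ∫⁻ u : logSpace K, ∫⁻ t, ENNReal.ofReal
        (rexp (s * t) * rexp (-π * weightedForm (logWeight (rexp t) u) a)) :=
        lintegral_lintegral_swap hm2.aemeasurable
    _ = ∫⁻ u : logSpace K, ∫⁻ t, ENNReal.ofReal (archKernel s (w₀ : InfinitePlace K).mult (w₀ a) t *
          ∏ i : {w : InfinitePlace K // w ≠ w₀}, archKernel s i.1.mult (i.1 a) (u i)) := by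
        refine lintegral_congr fun u => ?_
        rw [← lintegral_add_right_eq_self _ (∑ i, u i)]
        simp only [key]
    _ = ∏ w : InfinitePlace K, ∫⁻ v, ENNReal.ofReal (archKernel s w.mult (w a) v) := by
        rw [prod_eq_mul_prod_subtype_ne, ← lintegral_fintype_prod_ofReal
          (fun i => integrable_archKernel hs i.1.mult_pos (i.1.pos_iff.2 ha))
          (fun i x => archKernel_nonneg _ _ _ _), ← lintegral_const_mul']
        · refine lintegral_congr fun u => ?_
          rw [← lintegral_mul_const']
          · exact lintegral_congr fun t => ENNReal.ofReal_mul (archKernel_nonneg _ _ _ _)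
          · exact ENNReal.ofReal_ne_top
        · rw [lintegral_archKernel hs (InfinitePlace.mult_pos) (InfinitePlace.pos_iff.2 ha)]
          exact ENNReal.ofReal_ne_top
    _ = _ := by
        rw [Finset.prod_congr rfl fun w _ => lintegral_archKernel hs w.mult_pos (w.pos_iff.2 ha),
          ← ENNReal.ofReal_prod_of_nonneg, Finset.prod_mul_distrib,
          Real.finsetProd_rpow _ _ (fun w _ => by positivity), InfinitePlace.prod_eq_abs_norm]
        · push_cast
          rfl
        · exact fun w _ => mul_nonneg (by positivity) (archFactor_pos hs w.mult_pos).le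

end ArchimedeanIntegral

section UnfoldingLattice

open Real MeasureTheory NumberField.Units NumberField.Units.dirichletUnitTheorem
open scoped nonZeroDivisors Classical ENNReal

variable {K : Type*} [Field K] [NumberField K]

/-- The logarithmic embedding as a map onto the unit lattice. -/
noncomputable def toUnitLattice (ε : (𝓞 K)ˣ) : unitLattice K :=
  ⟨logEmbedding K (Additive.ofMul ε), Submodule.mem_map.2 ⟨Additive.ofMul ε, trivial, rfl⟩⟩

theorem toUnitLattice_surjective : Function.Surjective (toUnitLattice (K := K)) := by
  rintro ⟨x, hx⟩
  obtain ⟨ε, -, rfl⟩ := Submodule.mem_map.1 hx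
  exact ⟨ε.toMul, rfl⟩

theorem card_toUnitLattice_fiber (l : unitLattice K) :
    ENat.card (toUnitLattice ⁻¹' {l}) = torsionOrder K := by
  obtain ⟨ε, rfl⟩ := toUnitLattice_surjective l
  have e : torsion K ≃ toUnitLattice ⁻¹' {toUnitLattice ε} :=
    { toFun := fun t => ⟨ε * t, by
        simp only [Set.mem_preimage, Set.mem_singleton_iff, toUnitLattice, ofMul_mul, map_add,
          logEmbedding_eq_zero_iff.2 t.2, add_zero]⟩
      invFun := fun η => ⟨ε⁻¹ * η, by
        have h := congrArg Subtype.val η.2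
        simp only [toUnitLattice] at h
        rw [← logEmbedding_eq_zero_iff, ofMul_mul, map_add, h, ofMul_inv, map_neg,
          neg_add_cancel]⟩
      left_inv := fun t => by simp
      right_inv := fun η => by simp }
  rw [← ENat.card_congr e, ENat.card_eq_coe_natCard, torsionOrder]

theorem tsum_setLIntegral_add_logEmbedding {F : Set (logSpace K)}
    (hF : IsAddFundamentalDomain (unitLattice K) F volume) (h : logSpace K → ℝ≥0∞) :
    ∑' ε : (𝓞 K)ˣ, ∫⁻ u in F, h (u + logEmbedding K (Additive.ofMul ε)) =
      torsionOrder K * ∫⁻ u, h u := by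
  rw [← ENNReal.tsum_fiberwise _ toUnitLattice]
  have (l : unitLattice K) : ∑' ε : (toUnitLattice ⁻¹' {l} : Set (𝓞 K)ˣ),
      ∫⁻ u in F, h (u + logEmbedding K (Additive.ofMul (ε : (𝓞 K)ˣ))) =
      torsionOrder K * ∫⁻ u in F, h (l +ᵥ u) := by
    have h1 (ε : (toUnitLattice ⁻¹' {l} : Set (𝓞 K)ˣ)) :
        ∫⁻ u in F, h (u + logEmbedding K (Additive.ofMul (ε : (𝓞 K)ˣ))) =
        ∫⁻ u in F, h (l +ᵥ u) := by
      have : logEmbedding K (Additive.ofMul (ε : (𝓞 K)ˣ)) = l := congrArg Subtype.val ε.2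
      simp only [this, add_comm _ (l : logSpace K), Submodule.vadd_def, vadd_eq_add]
    rw [tsum_congr h1, ENNReal.tsum_const, card_toUnitLattice_fiber]
    simp
  have : VAddInvariantMeasure (unitLattice K) (logSpace K) volume :=
    inferInstanceAs <| VAddInvariantMeasure (unitLattice K).toAddSubgroup (logSpace K) volume
  rw [tsum_congr ‹_›, ENNReal.tsum_mul_left, hF.lintegral_eq_tsum'']

variable (K) in
/-- The class group of the ring of integers, as a quotient of the group of fractional ideals. -/
abbrev FractionalClassGroup : Type _ :=
  (FractionalIdeal (𝓞 K)⁰ K)ˣ ⧸ (toPrincipalIdeal (𝓞 K) K).range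

instance : Finite (FractionalClassGroup K) :=
  Finite.of_equiv _ (ClassGroup.equiv (R := 𝓞 K) K).toEquiv

/-- A nonzero ideal as an invertible fractional ideal. -/
noncomputable def idealUnit (I : {I : Ideal (𝓞 K) // I ≠ ⊥}) : (FractionalIdeal (𝓞 K)⁰ K)ˣ :=
  FractionalIdeal.mk0 K ⟨I.1, mem_nonZeroDivisors_iff_ne_zero.2 I.2⟩

theorem coe_idealUnit (I : {I : Ideal (𝓞 K) // I ≠ ⊥}) :
    (idealUnit I : FractionalIdeal (𝓞 K)⁰ K) = (I.1 : FractionalIdeal (𝓞 K)⁰ K) := rfl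

theorem idealUnit_injective : Function.Injective (idealUnit (K := K)) := fun I I' h => by
  have := congrArg Units.val h
  rw [coe_idealUnit, coe_idealUnit, FractionalIdeal.coeIdeal_inj] at this
  exact Subtype.ext this

/-- The ideals in the class inverse to that of `J`. -/
abbrev IdealsInverseTo (J : (FractionalIdeal (𝓞 K)⁰ K)ˣ) : Type _ :=
  {I : {I : Ideal (𝓞 K) // I ≠ ⊥} //
    (QuotientGroup.mk (idealUnit I) : FractionalClassGroup K) = (QuotientGroup.mk J)⁻¹}

theorem exists_spanSingleton_eq {J : (FractionalIdeal (𝓞 K)⁰ K)ˣ} (I : IdealsInverseTo J) :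
    ∃ x : Kˣ, toPrincipalIdeal (𝓞 K) K x = idealUnit I.1 * J := by
  have h : (QuotientGroup.mk (idealUnit I.1 * J) : FractionalClassGroup K) = 1 := by
    rw [QuotientGroup.mk_mul, I.2, inv_mul_cancel]
  exact (QuotientGroup.eq_one_iff _).1 h

/-- A generator of the principal fractional ideal `I * J`. -/
noncomputable def classGenerator {J : (FractionalIdeal (𝓞 K)⁰ K)ˣ} (I : IdealsInverseTo J) : Kˣ :=
  (exists_spanSingleton_eq I).choose

theorem spanSingleton_classGenerator {J : (FractionalIdeal (𝓞 K)⁰ K)ˣ} (I : IdealsInverseTo J) :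
    FractionalIdeal.spanSingleton (𝓞 K)⁰ (classGenerator I : K) =
      (idealUnit I.1 : FractionalIdeal (𝓞 K)⁰ K) * J := by
  have := congrArg Units.val (exists_spanSingleton_eq I).choose_spec
  rwa [coe_toPrincipalIdeal] at this

theorem abs_norm_classGenerator {J : (FractionalIdeal (𝓞 K)⁰ K)ˣ} (I : IdealsInverseTo J) :
    |(Algebra.norm ℚ (classGenerator I : K) : ℝ)| = (Ideal.absNorm I.1.1 : ℝ) *
      (FractionalIdeal.absNorm (J : FractionalIdeal (𝓞 K)⁰ K) : ℚ) := by
  have := congrArg FractionalIdeal.absNorm (spanSingleton_classGenerator I)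
  rw [FractionalIdeal.absNorm_span_singleton, map_mul, coe_idealUnit,
    FractionalIdeal.coeIdeal_absNorm] at this
  exact_mod_cast this

theorem spanSingleton_unit_mul (ε : (𝓞 K)ˣ) (a : K) :
    FractionalIdeal.spanSingleton (𝓞 K)⁰ ((ε : K) * a) =
      FractionalIdeal.spanSingleton (𝓞 K)⁰ a :=
  (FractionalIdeal.spanSingleton_eq_spanSingleton.2 ⟨ε, by rw [Units.smul_def, Algebra.smul_def]⟩).symm

theorem unit_mul_classGenerator_mem {J : (FractionalIdeal (𝓞 K)⁰ K)ˣ} (I : IdealsInverseTo J)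
    (ε : (𝓞 K)ˣ) : (ε : K) * classGenerator I ∈ (J : FractionalIdeal (𝓞 K)⁰ K) := by
  rw [← FractionalIdeal.spanSingleton_le_iff_mem, spanSingleton_unit_mul,
    spanSingleton_classGenerator]
  calc _ ≤ 1 * (J : FractionalIdeal (𝓞 K)⁰ K) :=
        mul_le_mul_left (by rw [coe_idealUnit]; exact FractionalIdeal.coeIdeal_le_one) _
    _ = _ := one_mul _

theorem bijective_unit_mul_classGenerator (J : (FractionalIdeal (𝓞 K)⁰ K)ˣ) :
    Function.Bijective fun p : IdealsInverseTo J × (𝓞 K)ˣ =>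
      (⟨(p.2 : K) * classGenerator p.1, unit_mul_classGenerator_mem p.1 p.2,
        mul_ne_zero (by simp) (classGenerator p.1).ne_zero⟩ :
        {a : K // a ∈ (J : FractionalIdeal (𝓞 K)⁰ K) ∧ a ≠ 0}) := by
  refine ⟨?_, ?_⟩
  · rintro ⟨I, ε⟩ ⟨I', ε'⟩ h
    have h := congrArg Subtype.val h
    simp only at h
    have h1 := congrArg (FractionalIdeal.spanSingleton (𝓞 K)⁰) h
    rw [spanSingleton_unit_mul, spanSingleton_unit_mul, spanSingleton_classGenerator,
      spanSingleton_classGenerator, ← Units.val_mul, ← Units.val_mul, Units.val_inj,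
      mul_left_inj, idealUnit_injective.eq_iff, Subtype.val_inj] at h1
    subst h1
    rw [mul_left_inj' (classGenerator I).ne_zero] at h
    refine Prod.ext rfl (Units.ext ?_)
    exact_mod_cast h
  · rintro ⟨a, haJ, ha⟩
    obtain ⟨I, hI⟩ := FractionalIdeal.le_one_iff_exists_coeIdeal (S := (𝓞 K)⁰) (P := K)
      (J := FractionalIdeal.spanSingleton (𝓞 K)⁰ a * (J⁻¹ : (FractionalIdeal (𝓞 K)⁰ K)ˣ)) |>.1 (by
        rw [← FractionalIdeal.spanSingleton_le_iff_mem] at haJ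
        calc _ ≤ (J : FractionalIdeal (𝓞 K)⁰ K) * (J⁻¹ : (FractionalIdeal (𝓞 K)⁰ K)ˣ) :=
              mul_le_mul_left haJ _
          _ = 1 := by simp)
    have hI0 : I ≠ ⊥ := by
      rintro rfl
      rw [FractionalIdeal.coeIdeal_bot, eq_comm, Units.mul_left_eq_zero,
        FractionalIdeal.spanSingleton_eq_zero_iff] at hI
      exact ha hI
    have h1 : toPrincipalIdeal (𝓞 K) K (Units.mk0 a ha) = idealUnit ⟨I, hI0⟩ * J := by
      refine Units.ext ?_
      rw [coe_toPrincipalIdeal, Units.val_mul, coe_idealUnit, hI, mul_assoc, ← Units.val_mul,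
        inv_mul_cancel, Units.val_one, mul_one, Units.val_mk0]
    have h2 : (QuotientGroup.mk (idealUnit ⟨I, hI0⟩) : FractionalClassGroup K) =
        (QuotientGroup.mk J)⁻¹ := by
      rw [eq_inv_iff_mul_eq_one, ← QuotientGroup.mk_mul, QuotientGroup.eq_one_iff]
      exact ⟨_, h1⟩
    have h3 : FractionalIdeal.spanSingleton (𝓞 K)⁰
        (classGenerator (⟨⟨I, hI0⟩, h2⟩ : IdealsInverseTo J) : K) =
        FractionalIdeal.spanSingleton (𝓞 K)⁰ a := by
      rw [spanSingleton_classGenerator, ← Units.val_mul, ← h1, coe_toPrincipalIdeal,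
        Units.val_mk0]
    obtain ⟨ε, hε⟩ := FractionalIdeal.spanSingleton_eq_spanSingleton.1 h3
    refine ⟨⟨⟨⟨I, hI0⟩, h2⟩, ε⟩, Subtype.ext ?_⟩
    exact (Algebra.smul_def _ _).symm.trans hε

variable (K) in
theorem exists_isAddFundamentalDomain_unitLattice :
    ∃ F : Set (logSpace K), IsAddFundamentalDomain (unitLattice K) F volume ∧
      volume F ≠ ∞ := by
  let b := Module.Free.chooseBasis ℤ (unitLattice K)
  exact ⟨_, ZLattice.isAddFundamentalDomain b volume,
    (ZSpan.fundamentalDomain_isBounded _).measure_lt_top.ne⟩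

theorem IsAddFundamentalDomain.neg_unitLattice {F : Set (logSpace K)}
    (hF : IsAddFundamentalDomain (unitLattice K) F volume) :
    IsAddFundamentalDomain (unitLattice K) (Neg.neg ⁻¹' F) volume := by
  refine hF.preimage_of_equiv (Measure.measurePreserving_neg volume).quasiMeasurePreserving
    (e := Neg.neg) neg_involutive.bijective fun g x => ?_
  simp only [Submodule.vadd_def, vadd_eq_add, NegMemClass.coe_neg, neg_add_rev, neg_neg, add_comm]

end UnfoldingLattice

section IdealTheta

open Real MeasureTheory NumberField.Units NumberField.Units.dirichletUnitTheorem
open scoped nonZeroDivisors Classical ENNReal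

variable {K : Type*} [Field K] [NumberField K]

variable (K) in
theorem countable_numberField : Countable K :=
  (Module.finBasis ℚ K).equivFun.injective.countable

theorem lintegral_Ioi_rpow_mul_comp_div {N : ℝ} (hN : 0 < N) (s : ℝ) (φ : ℝ → ℝ≥0∞) :
    ∫⁻ x in Set.Ioi (0 : ℝ), ENNReal.ofReal (x ^ (s - 1)) * φ (x / N) =
      ENNReal.ofReal (N ^ s) * ∫⁻ x in Set.Ioi (0 : ℝ), ENNReal.ofReal (x ^ (s - 1)) * φ x := by
  rw [lintegral_Ioi_zero_eq_lintegral_exp, lintegral_Ioi_zero_eq_lintegral_exp,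
    ← lintegral_const_mul' _ _ ENNReal.ofReal_ne_top,
    ← lintegral_add_right_eq_self _ (Real.log N)]
  refine lintegral_congr fun t => ?_
  rw [Real.exp_add, Real.exp_log hN, mul_div_cancel_right₀ _ hN.ne', ← mul_assoc, ← mul_assoc,
    ← mul_assoc, ← ENNReal.ofReal_mul (by positivity), ← ENNReal.ofReal_mul (by positivity),
    ← ENNReal.ofReal_mul (by positivity)]
  congr 2
  rw [Real.mul_rpow (Real.exp_pos t).le hN.le, Real.rpow_sub_one hN.ne']
  field_simp

/-- The Gaussian term attached to `a`, as an extended nonnegative real. -/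
noncomputable def gaussianTerm (a : K) (x : ℝ) (u : logSpace K) : ℝ≥0∞ :=
  ENNReal.ofReal (rexp (-π * weightedForm (logWeight x u) a))

theorem measurable_gaussianTerm (a : K) :
    Measurable fun p : ℝ × logSpace K => gaussianTerm a p.1 p.2 :=
  ((measurable_weightedForm_logWeight a).const_mul (-π)).exp.ennreal_ofReal

theorem gaussianTerm_unit_mul (x : ℝ) (u : logSpace K) (ε : (𝓞 K)ˣ) (a : K) :
    gaussianTerm ((ε : K) * a) x u =
      gaussianTerm a x (u + logEmbedding K (Additive.ofMul ε)) := by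
  rw [gaussianTerm, weightedForm_unit_mul, gaussianTerm]

/-- The theta series of the nonzero elements of a fractional ideal. -/
noncomputable def nonzeroTheta (J : (FractionalIdeal (𝓞 K)⁰ K)ˣ) (x : ℝ) (u : logSpace K) :
    ℝ≥0∞ :=
  ∑' a : {a : K // a ∈ (J : FractionalIdeal (𝓞 K)⁰ K) ∧ a ≠ 0}, gaussianTerm (a : K) x u

variable (K) in
/-- The archimedean factor of the completed Dedekind zeta function. -/
noncomputable def archFactorProd (s : ℝ) : ℝ := ∏ w : InfinitePlace K, archFactor s w.mult

theorem archFactorProd_pos {s : ℝ} (hs : 0 < s) : 0 < archFactorProd K s :=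
  Finset.prod_pos fun w _ => archFactor_pos hs w.mult_pos

theorem measurable_setLIntegral_gaussianTerm (F : Set (logSpace K)) (a : K) :
    Measurable fun x : ℝ => ∫⁻ u in F, gaussianTerm a x u :=
  (measurable_gaussianTerm a).lintegral_prod_right'

theorem lintegral_setLIntegral_nonzeroTheta {F : Set (logSpace K)}
    (hF : IsAddFundamentalDomain (unitLattice K) F volume)
    (J : (FractionalIdeal (𝓞 K)⁰ K)ˣ) {s : ℝ} (hs : 0 < s) :
    ∫⁻ x in Set.Ioi (0 : ℝ), ENNReal.ofReal (x ^ (s - 1)) * ∫⁻ u in F, nonzeroTheta J x u =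
      ∑' I : IdealsInverseTo J, torsionOrder K *
        ENNReal.ofReal (((Ideal.absNorm I.1.1 : ℝ) *
          (FractionalIdeal.absNorm (J : FractionalIdeal (𝓞 K)⁰ K) : ℚ)) ^ (-s) *
            archFactorProd K s) := by
  have := countable_numberField K
  have : Countable (𝓞 K)ˣ :=
    ((NumberField.RingOfIntegers.coe_injective (K := K)).comp Units.val_injective).countable
  have hm (a : K) : AEMeasurable (fun x : ℝ => ENNReal.ofReal (x ^ (s - 1)) *
      ∫⁻ u in F, gaussianTerm a x u) (volume.restrict (Set.Ioi 0)) :=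
    (Measurable.mul (by fun_prop) (measurable_setLIntegral_gaussianTerm F a)).aemeasurable
  have h1 (x : ℝ) : ∫⁻ u in F, nonzeroTheta J x u =
      ∑' a : {a : K // a ∈ (J : FractionalIdeal (𝓞 K)⁰ K) ∧ a ≠ 0},
        ∫⁻ u in F, gaussianTerm (a : K) x u :=
    lintegral_tsum fun a =>
      ((measurable_gaussianTerm (a : K)).comp measurable_prodMk_left).aemeasurable
  simp_rw [h1, ← ENNReal.tsum_mul_left]
  rw [lintegral_tsum fun a : {a : K // a ∈ (J : FractionalIdeal (𝓞 K)⁰ K) ∧ a ≠ 0} => hm a,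
    ← (Equiv.ofBijective _ (bijective_unit_mul_classGenerator J)).tsum_eq, ENNReal.tsum_prod']
  refine tsum_congr fun I => ?_
  simp only [Equiv.ofBijective_apply]
  rw [← lintegral_tsum fun ε => hm _, ← abs_norm_classGenerator, archFactorProd,
    ← lintegral_lintegral_exp_weightedForm hs (classGenerator I).ne_zero,
    ← lintegral_const_mul' _ _ (by simp)]
  refine lintegral_congr fun x => ?_
  simp_rw [ENNReal.tsum_mul_left, gaussianTerm_unit_mul]
  rw [tsum_setLIntegral_add_logEmbedding hF]
  simp_rw [gaussianTerm]
  ring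

/-- The sum over ideal classes of the theta integrals over a fundamental domain `F` of the unit
lattice. -/
noncomputable def classTheta (F : Set (logSpace K))
    (J : FractionalClassGroup K → (FractionalIdeal (𝓞 K)⁰ K)ˣ) (x : ℝ) : ℝ≥0∞ :=
  ∑' C, ∫⁻ u in F,
    nonzeroTheta (J C) (x / (FractionalIdeal.absNorm (J C : FractionalIdeal (𝓞 K)⁰ K) : ℚ)) u

theorem tsum_idealsInverseTo {J : FractionalClassGroup K → (FractionalIdeal (𝓞 K)⁰ K)ˣ}
    (hJ : Function.Bijective fun C => (QuotientGroup.mk (J C) : FractionalClassGroup K))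
    (f : {I : Ideal (𝓞 K) // I ≠ ⊥} → ℝ≥0∞) :
    ∑' C, ∑' I : IdealsInverseTo (J C), f I = ∑' I, f I := by
  rw [← ENNReal.tsum_fiberwise f fun I => (QuotientGroup.mk (idealUnit I) : FractionalClassGroup K),
    ← ((Equiv.ofBijective _ hJ).trans (Equiv.inv _)).tsum_eq
      fun x : FractionalClassGroup K => ∑' I : (fun I : {I : Ideal (𝓞 K) // I ≠ ⊥} =>
        (QuotientGroup.mk (idealUnit I) : FractionalClassGroup K)) ⁻¹' {x}, f I]
  rfl

theorem absNorm_unit_pos (J : (FractionalIdeal (𝓞 K)⁰ K)ˣ) :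
    (0 : ℝ) < (FractionalIdeal.absNorm (J : FractionalIdeal (𝓞 K)⁰ K) : ℚ) := by
  have := (FractionalIdeal.absNorm_nonneg (J : FractionalIdeal (𝓞 K)⁰ K)).lt_of_ne'
    (FractionalIdeal.absNorm_eq_zero_iff.not.2 J.ne_zero)
  exact_mod_cast this

theorem lintegral_classTheta {F : Set (logSpace K)}
    (hF : IsAddFundamentalDomain (unitLattice K) F volume)
    {J : FractionalClassGroup K → (FractionalIdeal (𝓞 K)⁰ K)ˣ}
    (hJ : Function.Bijective fun C => (QuotientGroup.mk (J C) : FractionalClassGroup K))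
    {s : ℝ} (hs : 0 < s) :
    ∫⁻ x in Set.Ioi (0 : ℝ), ENNReal.ofReal (x ^ (s - 1)) * classTheta F J x =
      torsionOrder K * ENNReal.ofReal (archFactorProd K s) *
        ∑' I : {I : Ideal (𝓞 K) // I ≠ ⊥},
          ENNReal.ofReal ((Ideal.absNorm I.1 : ℝ) ^ (-s)) := by
  have := countable_numberField K
  have hm (J : (FractionalIdeal (𝓞 K)⁰ K)ˣ) : Measurable fun x => ∫⁻ u in F, nonzeroTheta J x u :=
    Measurable.lintegral_prod_right' (f := fun p : ℝ × logSpace K => nonzeroTheta J p.1 p.2)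
      (Measurable.tsum fun a => measurable_gaussianTerm (a : K))
  simp_rw [classTheta, ← ENNReal.tsum_mul_left]
  have hm' (C : FractionalClassGroup K) : Measurable fun x : ℝ => ENNReal.ofReal (x ^ (s - 1)) *
      ∫⁻ u in F, nonzeroTheta (J C)
        (x / (FractionalIdeal.absNorm (J C : FractionalIdeal (𝓞 K)⁰ K) : ℚ)) u :=
    Measurable.mul (by fun_prop) ((hm (J C)).comp (measurable_id.div_const _))
  rw [lintegral_tsum fun C => (hm' C).aemeasurable, ← tsum_idealsInverseTo hJ]
  refine tsum_congr fun C => ?_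
  have hN := absNorm_unit_pos (J C)
  rw [lintegral_Ioi_rpow_mul_comp_div hN s fun x => ∫⁻ u in F, nonzeroTheta (J C) x u,
    lintegral_setLIntegral_nonzeroTheta hF _ hs, ← ENNReal.tsum_mul_left]
  refine tsum_congr fun I => ?_
  rw [mul_left_comm, ← ENNReal.ofReal_mul (by positivity), mul_assoc,
    ← ENNReal.ofReal_mul (archFactorProd_pos hs).le]
  congr 2
  rw [Real.mul_rpow (Nat.cast_nonneg _) hN.le, Real.rpow_neg hN.le]
  field_simp

end IdealTheta

section AntitoneMellin

open Real MeasureTheory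
open scoped ENNReal

variable {H : ℝ → ℝ≥0∞}

theorem AntitoneOn.mul_ofReal_le_lintegral_rpow (hH : AntitoneOn H (Set.Ioi 0)) {s : ℝ}
    (hs : 1 < s) {x : ℝ} (hx : 0 < x) :
    H x * ENNReal.ofReal ((x / 2) ^ s) ≤
      ∫⁻ t in Set.Ioi (0 : ℝ), ENNReal.ofReal (t ^ (s - 1)) * H t := by
  calc H x * ENNReal.ofReal ((x / 2) ^ s)
      = ∫⁻ _ in Set.Ioc (x / 2) x, ENNReal.ofReal ((x / 2) ^ (s - 1)) * H x := by
        rw [setLIntegral_const, Real.volume_Ioc, mul_right_comm, ← ENNReal.ofReal_mul (by positivity),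
          mul_comm, Real.rpow_sub_one (by positivity)]
        congr 2
        field_simp
        ring
    _ ≤ ∫⁻ t in Set.Ioc (x / 2) x, ENNReal.ofReal (t ^ (s - 1)) * H t := by
        refine setLIntegral_mono' measurableSet_Ioc fun t ht => ?_
        have ht0 : 0 < t := by linarith [ht.1]
        gcongr
        · exact ht.1.le
        · exact hH ht0 hx ht.2
    _ ≤ _ := lintegral_mono_set fun t ht => by
        exact (half_pos hx).trans ht.1

variable (hH : AntitoneOn H (Set.Ioi 0))
  (hM : ∀ s : ℝ, 1 < s → ∫⁻ t in Set.Ioi (0 : ℝ), ENNReal.ofReal (t ^ (s - 1)) * H t ≠ ∞)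

include hH hM

theorem AntitoneOn.ne_top_of_lintegral_rpow {x : ℝ} (hx : 0 < x) : H x ≠ ∞ := by
  intro h
  have := hH.mul_ofReal_le_lintegral_rpow one_lt_two hx
  rw [h, ENNReal.top_mul (by simpa using by positivity), top_le_iff] at this
  exact hM 2 one_lt_two this

theorem AntitoneOn.toReal_of_lintegral_rpow : AntitoneOn (fun x => (H x).toReal) (Set.Ioi 0) :=
  fun _ hx _ hy hxy => ENNReal.toReal_mono (hH.ne_top_of_lintegral_rpow hM hx) (hH hx hy hxy)

theorem AntitoneOn.locallyIntegrableOn_ofReal_toReal :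
    LocallyIntegrableOn (fun x => ((H x).toReal : ℂ)) (Set.Ioi 0) := by
  rw [locallyIntegrableOn_iff isOpen_Ioi.isLocallyClosed]
  intro k hk hkc
  exact ((hH.toReal_of_lintegral_rpow hM).mono hk |>.integrableOn_isCompact hkc).ofReal

theorem AntitoneOn.isBigO_atTop_ofReal_toReal (r : ℝ) :
    (fun x => ((H x).toReal : ℂ)) =O[atTop] fun x : ℝ => x ^ r := by
  set s := max 2 (-r)
  have hs : 1 < s := lt_of_lt_of_le one_lt_two (le_max_left _ _)
  set M := ∫⁻ t in Set.Ioi (0 : ℝ), ENNReal.ofReal (t ^ (s - 1)) * H t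
  refine Asymptotics.IsBigO.of_bound (2 ^ s * M.toReal) ?_
  filter_upwards [eventually_ge_atTop 1] with x hx
  have hx0 : 0 < x := by linarith
  have h := ENNReal.toReal_mono (hM s hs) (hH.mul_ofReal_le_lintegral_rpow hs hx0)
  rw [ENNReal.toReal_mul, ENNReal.toReal_ofReal (by positivity), Real.div_rpow hx0.le two_pos.le,
    ← mul_div_assoc, div_le_iff₀ (by positivity), ← le_div_iff₀ (by positivity)] at h
  rw [Complex.norm_real, Real.norm_of_nonneg ENNReal.toReal_nonneg,
    Real.norm_of_nonneg (by positivity)]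
  refine h.trans ?_
  rw [mul_comm M.toReal, div_eq_mul_inv, ← Real.rpow_neg hx0.le]
  gcongr
  exact neg_le.1 (le_max_right _ _)

theorem AntitoneOn.mellin_ofReal_toReal {s : ℝ} :
    mellin (fun x => ((H x).toReal : ℂ)) s =
      (∫⁻ t in Set.Ioi (0 : ℝ), ENNReal.ofReal (t ^ (s - 1)) * H t).toReal := by
  have h1 : mellin (fun x => ((H x).toReal : ℂ)) s =
      ∫ t in Set.Ioi (0 : ℝ), ((t ^ (s - 1) * (H t).toReal : ℝ) : ℂ) := by
    refine setIntegral_congr_fun measurableSet_Ioi fun t (ht : 0 < t) => ?_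
    simp only [smul_eq_mul]
    push_cast [Complex.ofReal_cpow ht.le]
    rfl
  rw [h1, integral_complex_ofReal, integral_eq_lintegral_of_nonneg_ae]
  · congr 2
    refine setLIntegral_congr_fun measurableSet_Ioi fun t (ht : 0 < t) => ?_
    rw [ENNReal.ofReal_mul (by positivity), ENNReal.ofReal_toReal
      (hH.ne_top_of_lintegral_rpow hM ht)]
  · filter_upwards [ae_restrict_mem measurableSet_Ioi] with t (ht : 0 < t)
    exact mul_nonneg (by positivity) ENNReal.toReal_nonneg
  · refine AEMeasurable.aestronglyMeasurable (AEMeasurable.mul (by fun_prop) ?_)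
    exact aemeasurable_restrict_of_antitoneOn measurableSet_Ioi (hH.toReal_of_lintegral_rpow hM)

end AntitoneMellin

section ClassThetaProperties

open Real MeasureTheory NumberField.Units NumberField.Units.dirichletUnitTheorem
open scoped nonZeroDivisors Classical ENNReal

variable {K : Type*} [Field K] [NumberField K]

theorem antitoneOn_classTheta (F : Set (logSpace K))
    (J : FractionalClassGroup K → (FractionalIdeal (𝓞 K)⁰ K)ˣ) :
    AntitoneOn (classTheta F J) (Set.Ioi 0) := by
  intro x (hx : 0 < x) y (hy : 0 < y) hxy
  unfold classTheta nonzeroTheta gaussianTerm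
  refine ENNReal.tsum_le_tsum fun C => lintegral_mono fun u => ENNReal.tsum_le_tsum fun a => ?_
  have hN := absNorm_unit_pos (J C)
  refine ENNReal.ofReal_le_ofReal (Real.exp_le_exp.2 ?_)
  simp only [neg_mul, neg_le_neg_iff]
  refine mul_le_mul_of_nonneg_left ?_ Real.pi_pos.le
  exact weightedForm_mono (fun w => (logWeight_pos _ _ w).le)
    (fun w => logWeight_mono (by positivity) (by gcongr) u w) _

theorem one_add_nonzeroTheta (J : (FractionalIdeal (𝓞 K)⁰ K)ˣ) (x : ℝ) (u : logSpace K) :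
    1 + nonzeroTheta J x u = ENNReal.ofReal (∑' a : {a : K // a ∈ (J : FractionalIdeal (𝓞 K)⁰ K)},
      rexp (-π * weightedForm (logWeight x u) (a : K))) := by
  have h0 : gaussianTerm (0 : K) x u = 1 := by simp [gaussianTerm, weightedForm]
  have h1 := tsum_subtype {a : K | a ∈ (J : FractionalIdeal (𝓞 K)⁰ K)} fun a => gaussianTerm a x u
  have h2 := tsum_subtype {a : K | a ∈ (J : FractionalIdeal (𝓞 K)⁰ K) ∧ a ≠ 0}
    fun a => gaussianTerm a x u
  have h3 := ENNReal.ofReal_tsum_of_nonneg (fun _ => (Real.exp_pos _).le)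
    (summable_exp_weightedForm (logWeight_pos x u) J)
  have h4 := ENNReal.tsum_eq_add_tsum_ite (f := Set.indicator
    {a : K | a ∈ (J : FractionalIdeal (𝓞 K)⁰ K)} fun a => gaussianTerm a x u) 0
  rw [Set.indicator_of_mem (Set.mem_ofPred.2 (FractionalIdeal.zero_mem _)), h0] at h4
  refine Eq.trans ?_ (h1.symm.trans h3.symm)
  refine Eq.trans ?_ h4.symm
  refine (congrArg (1 + ·) h2).trans ?_
  refine congrArg (1 + ·) (tsum_congr fun a => ?_)
  by_cases ha : a = 0 <;> simp [Set.indicator, ha]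

theorem one_add_nonzeroTheta_inv (J : (FractionalIdeal (𝓞 K)⁰ K)ˣ) {x : ℝ} (hx : 0 < x)
    (u : logSpace K) :
    1 + nonzeroTheta J x⁻¹ u =
      ENNReal.ofReal ((√|(discr K : ℝ)| *
        (FractionalIdeal.absNorm (J : FractionalIdeal (𝓞 K)⁰ K) : ℚ))⁻¹ * x) *
      (1 + nonzeroTheta (traceDualUnit J) x (-u)) := by
  have hN := absNorm_unit_pos J
  rw [one_add_nonzeroTheta, one_add_nonzeroTheta, ← ENNReal.ofReal_mul (by positivity),
    tsum_exp_weightedForm (logWeight_pos _ _), prod_logWeight (by positivity), inv_logWeight,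
    inv_inv]

end ClassThetaProperties

section ClassThetaFunctionalEquation

open Real MeasureTheory NumberField.Units NumberField.Units.dirichletUnitTheorem
open scoped nonZeroDivisors Classical ENNReal

variable {K : Type*} [Field K] [NumberField K]

theorem abs_discr_pos : 0 < |(discr K : ℝ)| := by
  have := discr_ne_zero K
  positivity

theorem setLIntegral_comp_neg (F : Set (logSpace K)) (g : logSpace K → ℝ≥0∞) :
    ∫⁻ u in F, g (-u) = ∫⁻ u in Neg.neg ⁻¹' F, g u := by
  have := (Measure.measurePreserving_neg (volume : Measure (logSpace K))).setLIntegral_comp_preimage_emb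
    (MeasurableEquiv.neg _).measurableEmbedding g (Neg.neg ⁻¹' F)
  rwa [← Set.preimage_comp, neg_comp_neg, Set.preimage_id] at this

theorem bijective_mk_traceDualUnit
    {J : FractionalClassGroup K → (FractionalIdeal (𝓞 K)⁰ K)ˣ}
    (hJ : Function.Bijective fun C => (QuotientGroup.mk (J C) : FractionalClassGroup K)) :
    Function.Bijective fun C =>
      (QuotientGroup.mk (traceDualUnit (J C)) : FractionalClassGroup K) := by
  have : (fun C => (QuotientGroup.mk (traceDualUnit (J C)) : FractionalClassGroup K)) =
      (((Equiv.ofBijective _ hJ).trans (Equiv.inv (FractionalClassGroup K))).trans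
        (Equiv.mulLeft (QuotientGroup.mk (traceDualUnit 1)))) := by
    ext C
    rw [traceDualUnit_eq]
    rfl
  rw [this]
  exact Equiv.bijective _

theorem classTheta_inv (F : Set (logSpace K))
    (J : FractionalClassGroup K → (FractionalIdeal (𝓞 K)⁰ K)ˣ) {x : ℝ} (hx : 0 < x) :
    ENat.card (FractionalClassGroup K) * volume F + classTheta F J x⁻¹ =
      ENNReal.ofReal ((√|(discr K : ℝ)|)⁻¹ * x) *
        (ENat.card (FractionalClassGroup K) * volume F +
          classTheta (Neg.neg ⁻¹' F) (fun C => traceDualUnit (J C)) (x / |(discr K : ℝ)|)) := by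
  have hd := abs_discr_pos (K := K)
  rw [← ENNReal.tsum_const, classTheta, classTheta, ← ENNReal.tsum_add, ← ENNReal.tsum_add,
    ← ENNReal.tsum_mul_left]
  refine tsum_congr fun C => ?_
  have hN := absNorm_unit_pos (J C)
  set N : ℝ := ((FractionalIdeal.absNorm (J C : FractionalIdeal (𝓞 K)⁰ K) : ℚ) : ℝ)
  have h1 : x⁻¹ / N = (x * N)⁻¹ := by rw [mul_inv]; rfl
  have h2 : x / |(discr K : ℝ)| / (FractionalIdeal.absNorm
      (traceDualUnit (J C) : FractionalIdeal (𝓞 K)⁰ K) : ℚ) = x * N := by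
    rw [absNorm_traceDualUnit]
    push_cast
    field_simp
    rfl
  have h3 (G : Set (logSpace K)) (g : logSpace K → ℝ≥0∞) :
      volume G + ∫⁻ u in G, g u = ∫⁻ u in G, (1 + g u) := by
    rw [lintegral_add_left measurable_const, setLIntegral_one]
  rw [h1, h2, h3, ← Measure.measure_preimage_neg volume F, h3, ← setLIntegral_comp_neg F,
    ← lintegral_const_mul' _ _ ENNReal.ofReal_ne_top]
  refine lintegral_congr fun u => ?_
  rw [one_add_nonzeroTheta_inv _ (by positivity)]
  congr 2
  field_simp
  rfl

variable {F : Set (logSpace K)} (hF : IsAddFundamentalDomain (unitLattice K) F volume)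
  {J : FractionalClassGroup K → (FractionalIdeal (𝓞 K)⁰ K)ˣ}
  (hJ : Function.Bijective fun C => (QuotientGroup.mk (J C) : FractionalClassGroup K))
  (hsum : ∀ s : ℝ, 1 < s → Summable fun I : {I : Ideal (𝓞 K) // I ≠ ⊥} =>
    (Ideal.absNorm I.1 : ℝ) ^ (-s))

include hsum in
theorem tsum_ofReal_absNorm_rpow {s : ℝ} (hs : 1 < s) :
    ∑' I : {I : Ideal (𝓞 K) // I ≠ ⊥}, ENNReal.ofReal ((Ideal.absNorm I.1 : ℝ) ^ (-s)) =
      ENNReal.ofReal (∑' I : {I : Ideal (𝓞 K) // I ≠ ⊥}, (Ideal.absNorm I.1 : ℝ) ^ (-s)) :=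
  (ENNReal.ofReal_tsum_of_nonneg (fun _ => by positivity) (hsum s hs)).symm

include hF hJ hsum

theorem lintegral_classTheta_ne_top (s : ℝ) (hs : 1 < s) :
    ∫⁻ x in Set.Ioi (0 : ℝ), ENNReal.ofReal (x ^ (s - 1)) * classTheta F J x ≠ ∞ := by
  rw [lintegral_classTheta hF hJ (by linarith), tsum_ofReal_absNorm_rpow hsum hs]
  finiteness

theorem mellin_classTheta {s : ℝ} (hs : 1 < s) :
    mellin (fun x => ((classTheta F J x).toReal : ℂ)) s =
      ((torsionOrder K * archFactorProd K s *
        ∑' I : {I : Ideal (𝓞 K) // I ≠ ⊥}, (Ideal.absNorm I.1 : ℝ) ^ (-s) : ℝ) : ℂ) := by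
  rw [(antitoneOn_classTheta F J).mellin_ofReal_toReal (lintegral_classTheta_ne_top hF hJ hsum),
    lintegral_classTheta hF hJ (by linarith), tsum_ofReal_absNorm_rpow hsum hs]
  rw [ENNReal.toReal_mul, ENNReal.toReal_mul, ENNReal.toReal_ofReal (archFactorProd_pos
    (by linarith)).le, ENNReal.toReal_ofReal (tsum_nonneg fun _ => by positivity),
    ENNReal.toReal_natCast]

theorem classTheta_ne_top {x : ℝ} (hx : 0 < x) : classTheta F J x ≠ ∞ :=
  (antitoneOn_classTheta F J).ne_top_of_lintegral_rpow (lintegral_classTheta_ne_top hF hJ hsum) hx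

theorem locallyIntegrableOn_classTheta :
    LocallyIntegrableOn (fun x => ((classTheta F J x).toReal : ℂ)) (Set.Ioi 0) :=
  (antitoneOn_classTheta F J).locallyIntegrableOn_ofReal_toReal
    (lintegral_classTheta_ne_top hF hJ hsum)

theorem isBigO_classTheta (r : ℝ) :
    (fun x => ((classTheta F J x).toReal : ℂ)) =O[atTop] fun x : ℝ => x ^ r :=
  (antitoneOn_classTheta F J).isBigO_atTop_ofReal_toReal
    (lintegral_classTheta_ne_top hF hJ hsum) r

theorem lintegral_classTheta_div_ne_top {d : ℝ} (hd : 0 < d) (s : ℝ) (hs : 1 < s) :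
    ∫⁻ x in Set.Ioi (0 : ℝ), ENNReal.ofReal (x ^ (s - 1)) * classTheta F J (x / d) ≠ ∞ := by
  rw [lintegral_Ioi_rpow_mul_comp_div hd]
  have := lintegral_classTheta_ne_top hF hJ hsum s hs
  finiteness

theorem mellin_classTheta_div {d : ℝ} (hd : 0 < d) {s : ℝ} (hs : 1 < s) :
    mellin (fun x => ((classTheta F J (x / d)).toReal : ℂ)) s =
      ((d ^ s * (torsionOrder K * archFactorProd K s *
        ∑' I : {I : Ideal (𝓞 K) // I ≠ ⊥}, (Ideal.absNorm I.1 : ℝ) ^ (-s)) : ℝ) : ℂ) := by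
  have h := mellin_comp_mul_left (fun x => ((classTheta F J x).toReal : ℂ)) s (inv_pos.2 hd)
  simp only [← div_eq_inv_mul] at h
  rw [h, mellin_classTheta hF hJ hsum hs, Complex.ofReal_mul (d ^ s), smul_eq_mul,
    Complex.ofReal_cpow hd.le, Complex.ofReal_inv, Complex.inv_cpow _ _
    (by simp [Complex.arg_ofReal_of_nonneg hd.le, Real.pi_pos.ne]), Complex.cpow_neg, inv_inv]

omit hF hJ hsum in
theorem antitoneOn_classTheta_div (F : Set (logSpace K))
    (J : FractionalClassGroup K → (FractionalIdeal (𝓞 K)⁰ K)ˣ) {d : ℝ} (hd : 0 < d) :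
    AntitoneOn (fun x => classTheta F J (x / d)) (Set.Ioi 0) :=
  fun _ hx _ hy hxy => antitoneOn_classTheta F J (div_pos hx hd) (div_pos hy hd) (by gcongr)

omit hF hJ hsum in
/-- The class number times the volume of `F`. -/
noncomputable def thetaConst (F : Set (logSpace K)) : ℝ :=
  ((ENat.card (FractionalClassGroup K) : ℝ≥0∞) * volume F).toReal

theorem toReal_classTheta_inv (hFv : volume F ≠ ∞) {x : ℝ} (hx : 0 < x) :
    thetaConst F + (classTheta F J x⁻¹).toReal = (√|(discr K : ℝ)|)⁻¹ * x * (thetaConst F +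
      (classTheta (Neg.neg ⁻¹' F) (fun C => traceDualUnit (J C)) (x / |(discr K : ℝ)|)).toReal) := by
  have hd := abs_discr_pos (K := K)
  have hV : (ENat.card (FractionalClassGroup K) : ℝ≥0∞) * volume F ≠ ∞ :=
    ENNReal.mul_ne_top (by simpa using (inferInstance : Finite (FractionalClassGroup K))) hFv
  have := congrArg ENNReal.toReal (classTheta_inv F J hx)
  rwa [ENNReal.toReal_mul, ENNReal.toReal_add hV (classTheta_ne_top hF hJ hsum (inv_pos.2 hx)),
    ENNReal.toReal_add hV (classTheta_ne_top (IsAddFundamentalDomain.neg_unitLattice hF)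
      (bijective_mk_traceDualUnit hJ) hsum (div_pos hx hd)),
    ENNReal.toReal_ofReal (by positivity)] at this

/-- The pair of functions whose Mellin transforms give the completed Dedekind zeta function. -/
noncomputable def classThetaPair (hFv : volume F ≠ ∞) : WeakFEPair ℂ where
  f x := thetaConst F + (classTheta F J x).toReal
  g x := thetaConst F + (classTheta (Neg.neg ⁻¹' F) (fun C => traceDualUnit (J C))
    (x / |(discr K : ℝ)|)).toReal
  k := 1
  ε := ((√|(discr K : ℝ)|)⁻¹ : ℝ)
  f₀ := thetaConst F
  g₀ := thetaConst F
  hf_int := (locallyIntegrableOn_const _).add (locallyIntegrableOn_classTheta hF hJ hsum)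
  hg_int := (locallyIntegrableOn_const _).add
    ((antitoneOn_classTheta_div _ _ abs_discr_pos).locallyIntegrableOn_ofReal_toReal
      (lintegral_classTheta_div_ne_top (IsAddFundamentalDomain.neg_unitLattice hF)
        (bijective_mk_traceDualUnit hJ) hsum abs_discr_pos))
  hk := one_pos
  hε := by
    have := abs_discr_pos (K := K)
    exact_mod_cast (show (√|(discr K : ℝ)|)⁻¹ ≠ 0 by positivity)
  h_feq x hx := by
    rw [one_div, Real.rpow_one, smul_eq_mul]
    exact_mod_cast toReal_classTheta_inv hF hJ hsum hFv hx
  hf_top r := by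
    simpa only [add_sub_cancel_left] using isBigO_classTheta hF hJ hsum r
  hg_top r := by
    simpa only [add_sub_cancel_left] using
      (antitoneOn_classTheta_div _ _ abs_discr_pos).isBigO_atTop_ofReal_toReal
      (lintegral_classTheta_div_ne_top (IsAddFundamentalDomain.neg_unitLattice hF)
        (bijective_mk_traceDualUnit hJ) hsum abs_discr_pos) r

theorem classThetaPair_Λ (hFv : volume F ≠ ∞) {s : ℝ} (hs : 1 < s) :
    (classThetaPair hF hJ hsum hFv).Λ s =
      ((torsionOrder K * archFactorProd K s *
        ∑' I : {I : Ideal (𝓞 K) // I ≠ ⊥}, (Ideal.absNorm I.1 : ℝ) ^ (-s) : ℝ) : ℂ) := by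
  rw [← mellin_classTheta hF hJ hsum hs,
    ← ((classThetaPair hF hJ hsum hFv).hasMellin (s := s) (by simpa [classThetaPair])).2]
  simp only [classThetaPair, add_sub_cancel_left]

theorem classThetaPair_symm_Λ (hFv : volume F ≠ ∞) {s : ℝ} (hs : 1 < s) :
    (classThetaPair hF hJ hsum hFv).symm.Λ s =
      ((|(discr K : ℝ)| ^ s * (torsionOrder K * archFactorProd K s *
        ∑' I : {I : Ideal (𝓞 K) // I ≠ ⊥}, (Ideal.absNorm I.1 : ℝ) ^ (-s)) : ℝ) : ℂ) := by
  rw [← mellin_classTheta_div (IsAddFundamentalDomain.neg_unitLattice hF)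
      (bijective_mk_traceDualUnit hJ) hsum abs_discr_pos hs,
    ← ((classThetaPair hF hJ hsum hFv).symm.hasMellin (s := s)
      (by simpa [classThetaPair, WeakFEPair.symm])).2]
  simp only [classThetaPair, WeakFEPair.symm, add_sub_cancel_left]

end ClassThetaFunctionalEquation

section DedekindFunctionalEquation

open MeasureTheory NumberField.Units NumberField.Units.dirichletUnitTheorem
open scoped nonZeroDivisors Real

theorem eqOn_compl_of_eqOn_real_gt_one {f g : ℂ → ℂ}
    (hf : ∀ s : ℂ, s ≠ 0 → s ≠ 1 → DifferentiableAt ℂ f s)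
    (hg : ∀ s : ℂ, s ≠ 0 → s ≠ 1 → DifferentiableAt ℂ g s)
    (hfg : ∀ s : ℝ, 1 < s → f s = g s) {s : ℂ} (hs0 : s ≠ 0) (hs1 : s ≠ 1) : f s = g s := by
  have hU : IsOpen ({0, 1}ᶜ : Set ℂ) := (Set.toFinite _).isClosed.isOpen_compl
  have hmem (s : ℂ) : s ∈ ({0, 1}ᶜ : Set ℂ) ↔ s ≠ 0 ∧ s ≠ 1 := by simp
  have han {h : ℂ → ℂ} (hh : ∀ s : ℂ, s ≠ 0 → s ≠ 1 → DifferentiableAt ℂ h s) :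
      AnalyticOnNhd ℂ h ({0, 1}ᶜ : Set ℂ) :=
    DifferentiableOn.analyticOnNhd (fun s hs =>
      (hh s ((hmem s).1 hs).1 ((hmem s).1 hs).2).differentiableWithinAt) hU
  have hconn : IsPreconnected ({0, 1}ᶜ : Set ℂ) :=
    ((Set.toFinite _).countable.isConnected_compl_of_one_lt_rank
      (by simp [Complex.rank_real_complex])).isPreconnected
  have h2 : (2 : ℂ) ∈ ({0, 1}ᶜ : Set ℂ) := by simp
  refine (han hf).eqOn_of_preconnected_of_frequently_eq (han hg) hconn h2 ?_
    ((hmem s).2 ⟨hs0, hs1⟩)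
  have ht : Tendsto (fun x : ℝ => (x : ℂ)) (𝓝[≠] 2) (𝓝[≠] ((2 : ℝ) : ℂ)) :=
    tendsto_nhdsWithin_of_tendsto_nhds_of_eventually_within _
      (Complex.continuous_ofReal.continuousAt.tendsto.mono_left nhdsWithin_le_nhds)
      (by filter_upwards [self_mem_nhdsWithin] with x hx
          exact Complex.ofReal_injective.ne hx)
  have hev : ∀ᶠ x : ℝ in 𝓝[≠] 2, f x = g x := by
    filter_upwards [mem_nhdsWithin_of_mem_nhds (lt_mem_nhds one_lt_two)] with x hx
    exact hfg x hx
  exact_mod_cast ht.frequently hev.frequently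

variable {K : Type*} [Field K] [NumberField K]

/-- The product of Gamma values attached to the infinite places. -/
noncomputable def gammaProd (r₁ r₂ : ℕ) (s : ℂ) : ℂ := Gamma (s / 2) ^ r₁ * Gamma s ^ r₂

theorem differentiable_inv_gammaProd (r₁ r₂ : ℕ) :
    Differentiable ℂ fun s => (gammaProd r₁ r₂ s)⁻¹ := by
  have h := Complex.differentiable_one_div_Gamma
  have : (fun s => (gammaProd r₁ r₂ s)⁻¹) =
      fun s => ((Gamma (s / 2))⁻¹) ^ r₁ * ((Gamma s)⁻¹) ^ r₂ := by
    ext s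
    rw [gammaProd, mul_inv, inv_pow, inv_pow]
  rw [this]
  exact ((h.comp (differentiable_id.div_const 2)).pow r₁).mul (h.pow r₂)

theorem gammaProd_ne_zero_of_re_pos (r₁ r₂ : ℕ) {s : ℂ} (hs : 0 < s.re) :
    gammaProd r₁ r₂ s ≠ 0 :=
  mul_ne_zero (pow_ne_zero _ (Gamma_ne_zero_of_re_pos (by simpa using hs)))
    (pow_ne_zero _ (Gamma_ne_zero_of_re_pos hs))

variable (K) in
/-- The constant `4 ^ r₂ * π ^ n`. -/
noncomputable def archConst : ℝ :=
  4 ^ InfinitePlace.nrComplexPlaces K * π ^ Module.finrank ℚ K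

theorem archConst_pos : 0 < archConst K := by unfold archConst; positivity

theorem archFactorProd_eq (s : ℝ) :
    ((archFactorProd K s : ℝ) : ℂ) = (2⁻¹ : ℂ) ^ InfinitePlace.nrRealPlaces K *
      (archConst K : ℂ) ^ (-(s : ℂ) / 2) *
      gammaProd (InfinitePlace.nrRealPlaces K) (InfinitePlace.nrComplexPlaces K) s := by
  classical
  have h1 : archFactorProd K s = archFactor s 1 ^ InfinitePlace.nrRealPlaces K *
      archFactor s 2 ^ InfinitePlace.nrComplexPlaces K := by
    have (w : InfinitePlace K) : archFactor s w.mult =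
        if w.IsReal then archFactor s 1 else archFactor s 2 := by
      rw [InfinitePlace.mult]; split_ifs <;> rfl
    rw [archFactorProd, Finset.prod_congr rfl fun w _ => this w, Finset.prod_ite,
      Finset.prod_const, Finset.prod_const]
    simp only [InfinitePlace.not_isReal_iff_isComplex]
    rw [InfinitePlace.nrRealPlaces, InfinitePlace.nrComplexPlaces, Fintype.card_subtype,
      Fintype.card_subtype]
  have h2 : archFactor s 1 = 2⁻¹ * π ^ (-s / 2) * Real.Gamma (s / 2) := by
    rw [archFactor]
    norm_num only [Nat.cast_one, mul_one, one_mul]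
    rw [neg_div, mul_comm (π ^ _)]
  have h3 : archFactor s 2 = (4 : ℝ) ^ (-s / 2) * (π ^ (-s / 2)) ^ 2 * Real.Gamma s := by
    have : (4 : ℝ) * π ^ 2 = (π * 2) ^ 2 := by ring
    rw [← Real.rpow_natCast, ← Real.rpow_mul Real.pi_pos.le, mul_comm (-s / 2),
      Real.rpow_mul Real.pi_pos.le, Real.rpow_natCast, ← Real.mul_rpow (by norm_num)
        (by positivity), this, ← Real.rpow_natCast, ← Real.rpow_mul (by positivity)]
    rw [archFactor]
    push_cast
    rw [show (2 : ℝ) * (-s / 2) = -(2 * s / 2) by ring, show 2 * s / 2 = s by ring]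
    ring
  have h4 : archConst K ^ (-s / 2) = ((4 : ℝ) ^ (-s / 2)) ^ InfinitePlace.nrComplexPlaces K *
      (π ^ (-s / 2)) ^ InfinitePlace.nrRealPlaces K *
      ((π ^ (-s / 2)) ^ 2) ^ InfinitePlace.nrComplexPlaces K := by
    rw [archConst, Real.mul_rpow (by positivity) (by positivity), ← pow_mul, mul_assoc, ← pow_add,
      InfinitePlace.card_add_two_mul_card_eq_rank, Real.rpow_pow_comm (by norm_num),
      Real.rpow_pow_comm (by positivity)]
  have h5 : (archConst K : ℂ) ^ (-(s : ℂ) / 2) = ((archConst K ^ (-s / 2) : ℝ) : ℂ) := by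
    rw [Complex.ofReal_cpow archConst_pos.le]
    push_cast
    rfl
  rw [h5, h4, h1, h2, h3, gammaProd, Complex.Gamma_ofReal,
    show (s : ℂ) / 2 = ((s / 2 : ℝ) : ℂ) by push_cast; rfl, Complex.Gamma_ofReal]
  push_cast
  simp only [mul_pow]
  ring

theorem dedekindZeta_functional_equation {ζK : ℂ → ℂ}
    (hζ_an : ∀ s : ℂ, s ≠ 1 → DifferentiableAt ℂ ζK s)
    (hζ_ser : ∀ s : ℂ, 1 < s.re → HasSum (fun I : {I : Ideal (𝓞 K) // I ≠ ⊥} =>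
      ((Ideal.absNorm I.1 : ℕ) : ℂ) ^ (-s)) (ζK s))
    {s : ℂ} (hs0 : s ≠ 0) (hs1 : s ≠ 1)
    (hG : gammaProd (InfinitePlace.nrRealPlaces K) (InfinitePlace.nrComplexPlaces K) s ≠ 0)
    (hG' : gammaProd (InfinitePlace.nrRealPlaces K) (InfinitePlace.nrComplexPlaces K) (1 - s) ≠ 0) :
    ((|(discr K : ℝ)| / archConst K : ℝ) : ℂ) ^ (s - 1 / 2) *
        gammaProd (InfinitePlace.nrRealPlaces K) (InfinitePlace.nrComplexPlaces K) s * ζK s =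
      gammaProd (InfinitePlace.nrRealPlaces K) (InfinitePlace.nrComplexPlaces K) (1 - s) *
        ζK (1 - s) := by
  obtain ⟨F, hF, hFv⟩ := exists_isAddFundamentalDomain_unitLattice K
  have hJ : Function.Bijective fun C : FractionalClassGroup K =>
      (QuotientGroup.mk (Quotient.out C) : FractionalClassGroup K) := by
    convert Function.bijective_id using 1
    ext C
    exact Quotient.out_eq C
  have hpos (I : {I : Ideal (𝓞 K) // I ≠ ⊥}) : (0 : ℝ) ≤ (Ideal.absNorm I.1 : ℝ) :=
    Nat.cast_nonneg _
  have hcast (s : ℝ) (I : {I : Ideal (𝓞 K) // I ≠ ⊥}) :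
      ((Ideal.absNorm I.1 : ℕ) : ℂ) ^ (-(s : ℂ)) = (((Ideal.absNorm I.1 : ℝ) ^ (-s) : ℝ) : ℂ) := by
    rw [Complex.ofReal_cpow (hpos I)]
    push_cast
    rfl
  have hsum (s : ℝ) (hs : 1 < s) :
      Summable fun I : {I : Ideal (𝓞 K) // I ≠ ⊥} => (Ideal.absNorm I.1 : ℝ) ^ (-s) := by
    have := (hζ_ser s (by simpa using hs)).summable
    simp only [hcast] at this
    exact_mod_cast this
  have hval (s : ℝ) (hs : 1 < s) :
      ((∑' I : {I : Ideal (𝓞 K) // I ≠ ⊥}, (Ideal.absNorm I.1 : ℝ) ^ (-s) : ℝ) : ℂ) = ζK s := by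
    have := (hζ_ser s (by simpa using hs)).tsum_eq
    simp only [hcast] at this
    rw [← this, Complex.ofReal_tsum]
  set r := InfinitePlace.nrRealPlaces K with hr
  set r' := InfinitePlace.nrComplexPlaces K with hr'
  set P := classThetaPair hF hJ hsum hFv
  have hd : ((|(discr K : ℝ)| : ℝ) : ℂ) ≠ 0 := by exact_mod_cast (abs_discr_pos (K := K)).ne'
  have hM : (archConst K : ℂ) ≠ 0 := by exact_mod_cast (archConst_pos (K := K)).ne'
  have hw : ((torsionOrder K : ℕ) : ℂ) ≠ 0 := by exact_mod_cast torsionOrder_ne_zero K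
  have hdiff {Q : WeakFEPair ℂ} (hQ : Q.k = 1) (s : ℂ) (h0 : s ≠ 0) (h1 : s ≠ 1) :
      DifferentiableAt ℂ (fun s => Q.Λ s * (gammaProd r r' s)⁻¹) s :=
    (Q.differentiableAt_Λ (.inl h0) (.inl (by rw [hQ]; exact_mod_cast h1))).mul
      (differentiable_inv_gammaProd r r' s)
  have hdiff' (s : ℂ) (h1 : s ≠ 1) : DifferentiableAt ℂ (fun s => torsionOrder K *
      ((2⁻¹ : ℂ) ^ r * (archConst K : ℂ) ^ (-s / 2)) * ζK s) s := by
    refine DifferentiableAt.mul ?_ (hζ_an s h1)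
    refine DifferentiableAt.const_mul (DifferentiableAt.const_mul ?_ _) _
    exact DifferentiableAt.const_cpow (by fun_prop) (.inl hM)
  have hΛ (s : ℂ) (h0 : s ≠ 0) (h1 : s ≠ 1) : P.Λ s * (gammaProd r r' s)⁻¹ =
      torsionOrder K * ((2⁻¹ : ℂ) ^ r * (archConst K : ℂ) ^ (-s / 2)) * ζK s := by
    refine eqOn_compl_of_eqOn_real_gt_one (hdiff (Q := P) rfl) (fun s _ h => hdiff' s h) ?_ h0 h1
    intro x hx
    have hne : gammaProd r r' x ≠ 0 := gammaProd_ne_zero_of_re_pos _ _ (by simp; linarith)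
    rw [classThetaPair_Λ hF hJ hsum hFv hx, Complex.ofReal_mul, Complex.ofReal_mul, hval x hx,
      archFactorProd_eq, ← hr, ← hr', Complex.ofReal_natCast]
    field_simp
  have hΛ' (s : ℂ) (h0 : s ≠ 0) (h1 : s ≠ 1) : P.symm.Λ s * (gammaProd r r' s)⁻¹ =
      ((|(discr K : ℝ)| : ℝ) : ℂ) ^ s *
        (torsionOrder K * ((2⁻¹ : ℂ) ^ r * (archConst K : ℂ) ^ (-s / 2)) * ζK s) := by
    refine eqOn_compl_of_eqOn_real_gt_one (g := fun s => ((|(discr K : ℝ)| : ℝ) : ℂ) ^ s *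
        (torsionOrder K * ((2⁻¹ : ℂ) ^ r * (archConst K : ℂ) ^ (-s / 2)) * ζK s))
      (hdiff (Q := P.symm) rfl) (fun s _ h => ?_) ?_ h0 h1
    · exact DifferentiableAt.mul (DifferentiableAt.const_cpow (by fun_prop) (.inl hd)) (hdiff' s h)
    intro x hx
    have hne : gammaProd r r' x ≠ 0 := gammaProd_ne_zero_of_re_pos _ _ (by simp; linarith)
    rw [classThetaPair_symm_Λ hF hJ hsum hFv hx, Complex.ofReal_mul, Complex.ofReal_mul,
      Complex.ofReal_mul, hval x hx, archFactorProd_eq, ← hr, ← hr', Complex.ofReal_natCast,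
      Complex.ofReal_cpow abs_discr_pos.le]
    field_simp
  have hFE : P.Λ (1 - s) = (((√|(discr K : ℝ)|)⁻¹ : ℝ) : ℂ) * P.symm.Λ s := by
    have := P.functional_equation s
    rwa [show P.k = 1 from rfl, Complex.ofReal_one, smul_eq_mul] at this
  have h1 := hΛ (1 - s) (sub_ne_zero.2 hs1.symm) (by simpa using hs0)
  have h2 := hΛ' s hs0 hs1
  rw [mul_inv_eq_iff_eq_mul₀ hG'] at h1
  rw [mul_inv_eq_iff_eq_mul₀ hG] at h2
  rw [h1, h2] at hFE
  have hsqrt : (((√|(discr K : ℝ)|)⁻¹ : ℝ) : ℂ) = ((|(discr K : ℝ)| : ℝ) : ℂ) ^ (-(1 / 2) : ℂ) := by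
    rw [Real.sqrt_eq_rpow, ← Real.rpow_neg abs_discr_pos.le, Complex.ofReal_cpow abs_discr_pos.le]
    push_cast
    rfl
  have hMs : (archConst K : ℂ) ^ (-(1 - s) / 2) =
      (archConst K : ℂ) ^ (-s / 2) * (archConst K : ℂ) ^ (s - 1 / 2) := by
    rw [← Complex.cpow_add _ _ hM]
    ring_nf
  have hds : ((|(discr K : ℝ)| : ℝ) : ℂ) ^ (s - 1 / 2) =
      ((|(discr K : ℝ)| : ℝ) : ℂ) ^ (-(1 / 2) : ℂ) * ((|(discr K : ℝ)| : ℝ) : ℂ) ^ s := by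
    rw [← Complex.cpow_add _ _ hd]
    ring_nf
  have hMne (z : ℂ) : (archConst K : ℂ) ^ z ≠ 0 := by simp [Complex.cpow_eq_zero_iff, hM]
  have hdM : ((|(discr K : ℝ)| / archConst K : ℝ) : ℂ) ^ (s - 1 / 2) =
      ((|(discr K : ℝ)| : ℝ) : ℂ) ^ (s - 1 / 2) / (archConst K : ℂ) ^ (s - 1 / 2) := by
    rw [eq_div_iff (hMne _), ← Complex.mul_cpow_ofReal_nonneg
      (div_pos abs_discr_pos archConst_pos).le archConst_pos.le, ← Complex.ofReal_mul,
      div_mul_cancel₀ _ archConst_pos.ne']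
  rw [hdM, hds, div_mul_eq_mul_div, div_mul_eq_mul_div, div_eq_iff (hMne _)]
  rw [hsqrt, hMs] at hFE
  have h2r : (2⁻¹ : ℂ) ^ r ≠ 0 := pow_ne_zero _ (by norm_num)
  have hne := mul_ne_zero (mul_ne_zero hw h2r) (hMne (-s / 2))
  apply mul_left_cancel₀ hne
  linear_combination -hFE

end DedekindFunctionalEquation

section GammaContour

open MeasureTheory Set
open scoped Real

theorem norm_Gamma_le_Gamma_re {s : ℂ} (hs : 0 < s.re) : ‖Gamma s‖ ≤ Real.Gamma s.re := by
  rw [Complex.Gamma_eq_integral hs, Real.Gamma_eq_integral hs, Complex.GammaIntegral]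
  refine (norm_integral_le_integral_norm _).trans_eq (setIntegral_congr_fun measurableSet_Ioi ?_)
  intro x hx
  simp [norm_cpow_eq_rpow_re_of_pos (mem_Ioi.1 hx), Complex.norm_exp]

theorem norm_Gamma_le_inv_add_im_sq {s : ℂ} {ε : ℝ} (hε : 0 < ε) (h1 : -(1 / 2) ≤ s.re)
    (h2 : s.re ≤ -ε) : ‖Gamma s‖ ≤ (ε ^ 2 + s.im ^ 2)⁻¹ := by
  have hA : 0 < ε ^ 2 + s.im ^ 2 := by positivity
  have hs0 : s ≠ 0 := by rintro rfl; simp at h2; linarith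
  have hs1 : s + 1 ≠ 0 := fun h => by
    have := congrArg Complex.re h
    simp at this
    linarith
  have hΓ : ‖Gamma (s + 1 + 1)‖ ≤ 1 := by
    refine (norm_Gamma_le_Gamma_re (by simp; linarith)).trans ?_
    have := Real.convexOn_Gamma.le_max_of_mem_Icc (x := 1) (y := 2) (z := (s + 1 + 1).re)
      (by simp) (by simp) ⟨by simp; linarith, by simp; linarith⟩
    simpa using this
  rw [Complex.Gamma_add_one _ hs1, Complex.Gamma_add_one _ hs0, norm_mul, norm_mul] at hΓ
  have hn0 : ε ^ 2 + s.im ^ 2 ≤ ‖s‖ ^ 2 := by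
    rw [Complex.sq_norm, Complex.normSq_apply]
    nlinarith
  have hn1 : ε ^ 2 + s.im ^ 2 ≤ ‖s + 1‖ ^ 2 := by
    rw [Complex.sq_norm, Complex.normSq_apply]
    simp only [add_re, one_re, add_im, one_im, add_zero]
    nlinarith
  have hn : ε ^ 2 + s.im ^ 2 ≤ ‖s + 1‖ * ‖s‖ := by
    refine (pow_le_pow_iff_left₀ hA.le (by positivity) two_ne_zero).1 ?_
    rw [mul_pow, sq (ε ^ 2 + s.im ^ 2)]
    exact mul_le_mul hn1 hn0 hA.le (by positivity)
  rw [← one_div, le_div_iff₀ hA]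
  refine le_trans ?_ hΓ
  rw [mul_comm, ← mul_assoc]
  gcongr

theorem norm_gammaProd_le {r₁ r₂ : ℕ} (hr : r₁ + r₂ ≠ 0) {s : ℂ} {δ : ℝ} (hδ : 0 < δ)
    (h1 : -(1 / 2) ≤ s.re) (h2 : s.re ≤ -δ) :
    ‖gammaProd r₁ r₂ s‖ ≤ (4 / δ ^ 2) ^ (r₁ + r₂) * (1 + s.im ^ 2)⁻¹ := by
  have hδ1 : δ ≤ 1 := by linarith
  have hq : (δ ^ 2 + s.im ^ 2)⁻¹ ≤ (δ ^ 2)⁻¹ * (1 + s.im ^ 2)⁻¹ := by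
    rw [← mul_inv]
    gcongr
    nlinarith [sq_nonneg s.im, mul_le_one₀ hδ1 hδ.le hδ1]
  have hG1 : ‖Gamma (s / 2)‖ ≤ 4 / δ ^ 2 * (1 + s.im ^ 2)⁻¹ := by
    have := norm_Gamma_le_inv_add_im_sq (s := s / 2) (half_pos hδ) (by simp; linarith)
      (by simp; linarith)
    refine this.trans ?_
    rw [show (δ / 2) ^ 2 + (s / 2).im ^ 2 = (δ ^ 2 + s.im ^ 2) / 4 by simp; ring, inv_div,
      div_eq_mul_inv, div_eq_mul_inv, mul_assoc]
    gcongr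
  have hG2 : ‖Gamma s‖ ≤ 4 / δ ^ 2 * (1 + s.im ^ 2)⁻¹ := by
    refine ((norm_Gamma_le_inv_add_im_sq hδ h1 h2).trans hq).trans ?_
    gcongr
    rw [inv_eq_one_div]
    gcongr
    norm_num
  have hle : (1 + s.im ^ 2)⁻¹ ≤ 1 := inv_le_one_of_one_le₀ (by nlinarith [sq_nonneg s.im])
  calc ‖gammaProd r₁ r₂ s‖ = ‖Gamma (s / 2)‖ ^ r₁ * ‖Gamma s‖ ^ r₂ := by
        rw [gammaProd, norm_mul, norm_pow, norm_pow]
    _ ≤ (4 / δ ^ 2 * (1 + s.im ^ 2)⁻¹) ^ r₁ * (4 / δ ^ 2 * (1 + s.im ^ 2)⁻¹) ^ r₂ := by gcongr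
    _ = (4 / δ ^ 2) ^ (r₁ + r₂) * (1 + s.im ^ 2)⁻¹ ^ (r₁ + r₂) := by rw [← pow_add, mul_pow]
    _ ≤ _ := by
      gcongr
      exact pow_le_of_le_one (by positivity) hle hr

theorem ne_neg_natCast_of_re_mem_Ioo {s : ℂ} (h1 : -1 < s.re) (h2 : s.re < 0) (m : ℕ) :
    s ≠ -m := by
  rintro rfl
  simp at h1 h2
  omega

theorem differentiableAt_gammaProd (r₁ r₂ : ℕ) {s : ℂ} (h1 : -1 < s.re) (h2 : s.re < 0) :
    DifferentiableAt ℂ (gammaProd r₁ r₂) s := by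
  have h := Complex.differentiableAt_Gamma s (ne_neg_natCast_of_re_mem_Ioo h1 h2)
  have h' : DifferentiableAt ℂ Gamma (s / 2) := Complex.differentiableAt_Gamma _
    (ne_neg_natCast_of_re_mem_Ioo (by simp; linarith) (by simp; linarith))
  exact ((h'.comp s (by fun_prop : DifferentiableAt ℂ (fun s : ℂ => s / 2) s)).pow r₁).mul
    (h.pow r₂)

theorem gammaProd_ne_zero (r₁ r₂ : ℕ) {s : ℂ} (h1 : -1 < s.re) (h2 : s.re < 0) :
    gammaProd r₁ r₂ s ≠ 0 :=
  mul_ne_zero (pow_ne_zero _ (Complex.Gamma_ne_zero (ne_neg_natCast_of_re_mem_Ioo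
      (by simp; linarith) (by simp; linarith))))
    (pow_ne_zero _ (Complex.Gamma_ne_zero (ne_neg_natCast_of_re_mem_Ioo h1 h2)))

theorem integrable_of_norm_le_inv_one_add_sq {f : ℝ → ℂ} {C : ℝ} (hf : Continuous f)
    (hC : ∀ y, ‖f y‖ ≤ C * (1 + y ^ 2)⁻¹) : Integrable f :=
  (integrable_inv_one_add_sq.const_mul C).mono' hf.aestronglyMeasurable (.of_forall hC)

/-- Contour shift between two vertical lines for a function decaying quadratically on the strip. -/
theorem integral_vertical_line_eq {f : ℂ → ℂ} {a b C : ℝ} (hab : a ≤ b)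
    (hf : ∀ s : ℂ, s.re ∈ Icc a b → DifferentiableAt ℂ f s)
    (hC : ∀ s : ℂ, s.re ∈ Icc a b → ‖f s‖ ≤ C * (1 + s.im ^ 2)⁻¹) :
    ∫ y : ℝ, f (a + y * I) = ∫ y : ℝ, f (b + y * I) := by
  have h_int (σ : ℝ) (hσ : σ ∈ Icc a b) : Integrable fun y : ℝ => f (σ + y * I) := by
    refine integrable_of_norm_le_inv_one_add_sq (C := C) ?_ fun y => ?_
    · refine continuous_iff_continuousAt.2 fun y => ?_
      exact ContinuousAt.comp (g := f) (f := fun y : ℝ => (σ + y * I : ℂ))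
        (hf _ (by simpa using hσ)).continuousAt (by fun_prop)
    · simpa using hC (σ + y * I) (by simpa using hσ)
  have hvert (σ : ℝ) (hσ : σ ∈ Icc a b) :
      Tendsto (fun T : ℝ => ∫ y in -T..T, f (σ + y * I)) atTop (𝓝 (∫ y : ℝ, f (σ + y * I))) :=
    intervalIntegral_tendsto_integral (h_int σ hσ) tendsto_neg_atTop_atBot tendsto_id
  have hhor {u : ℝ → ℝ} (hu : Tendsto (fun T => u T ^ 2) atTop atTop) :
      Tendsto (fun T : ℝ => ∫ x in a..b, f (x + u T * I)) atTop (𝓝 0) := by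
    have hlim : Tendsto (fun T => C * (1 + u T ^ 2)⁻¹ * |b - a|) atTop (𝓝 0) := by
      have := ((tendsto_inv_atTop_zero.comp (tendsto_atTop_add_const_left _ 1 hu)).const_mul
        C).mul_const |b - a|
      simpa using this
    refine squeeze_zero_norm (fun T => intervalIntegral.norm_integral_le_of_norm_le_const ?_) hlim
    intro x hx
    rw [uIoc_of_le hab] at hx
    simpa using hC (x + u T * I) (by simpa using Ioc_subset_Icc_self hx)
  have hrect (T : ℝ) : (∫ x in a..b, f (x + (-T : ℝ) * I)) - (∫ x in a..b, f (x + T * I)) +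
      I * (∫ y in -T..T, f (b + y * I)) - I * (∫ y in -T..T, f (a + y * I)) = 0 := by
    have := integral_boundary_rect_eq_zero_of_differentiableOn f (a + (-T : ℝ) * I) (b + T * I) ?_
    · simpa using this
    · intro s hs
      refine (hf s ?_).differentiableWithinAt
      have := hs.1
      simpa [uIcc_of_le hab] using this
  have hlim := (((hhor (u := fun T => -T) (by simp)).sub
    (hhor (u := fun T => T) (tendsto_pow_atTop two_ne_zero))).add
    ((hvert b ⟨hab, le_rfl⟩).const_mul I)).sub ((hvert a ⟨le_rfl, hab⟩).const_mul I)
  simp only [hrect] at hlim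
  have := tendsto_nhds_unique hlim tendsto_const_nhds
  rw [sub_zero, zero_add, ← mul_sub, mul_eq_zero, or_iff_right I_ne_zero, sub_eq_zero] at this
  exact this.symm

theorem mellinInv_gammaProd_of_le {r₁ r₂ : ℕ} (hr : r₁ + r₂ ≠ 0) {a b x : ℝ} (ha : -(1 / 2) < a)
    (hab : a ≤ b) (hb : b < 0) (hx : 0 < x) :
    mellinInv a (gammaProd r₁ r₂) x = mellinInv b (gammaProd r₁ r₂) x := by
  have hx0 : (x : ℂ) ≠ 0 := by exact_mod_cast hx.ne'
  unfold mellinInv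
  congr 1
  refine integral_vertical_line_eq (f := fun s => (x : ℂ) ^ (-s) • gammaProd r₁ r₂ s)
    (C := (x ^ (-a) + x ^ (-b)) * (4 / (-b) ^ 2) ^ (r₁ + r₂)) hab ?_ ?_
  · intro s hs
    exact (DifferentiableAt.const_cpow (by fun_prop) (.inl hx0)).smul
      (differentiableAt_gammaProd _ _ (by linarith [hs.1]) (by linarith [hs.2]))
  · intro s hs
    rw [norm_smul, norm_cpow_eq_rpow_re_of_pos hx, mul_assoc]
    refine mul_le_mul ?_ (norm_gammaProd_le hr (neg_pos.2 hb) (by linarith [hs.1])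
      (by linarith [hs.2])) (norm_nonneg _) (by positivity)
    rw [neg_re]
    rcases le_total 1 x with h | h
    · exact (Real.rpow_le_rpow_of_exponent_le h (neg_le_neg hs.1)).trans
        (le_add_of_nonneg_right (by positivity))
    · exact (Real.rpow_le_rpow_of_exponent_ge hx h (neg_le_neg hs.2)).trans
        (le_add_of_nonneg_left (by positivity))

theorem Z_eq_mellinInv {r₁ r₂ : ℕ} (hr : r₁ + r₂ ≠ 0) {c x : ℝ} (h1 : -(1 / 2) < c) (h2 : c < 0)
    (hx : 0 < x) : Z r₁ r₂ x = mellinInv c (gammaProd r₁ r₂) x := by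
  change mellinInv (-(1 / 4)) (gammaProd r₁ r₂) x = _
  rcases le_total (-(1 / 4)) c with h | h
  · exact mellinInv_gammaProd_of_le hr (by norm_num) h h2 hx
  · exact (mellinInv_gammaProd_of_le hr h1 h (by norm_num) hx).symm

end GammaContour

theorem gammaProd_div_dedekindZeta_one_sub {K : Type*} [Field K] [NumberField K] {ζK : ℂ → ℂ}
    (hζ_an : ∀ s : ℂ, s ≠ 1 → DifferentiableAt ℂ ζK s)
    (hζ_ser : ∀ s : ℂ, 1 < s.re → HasSum (fun I : {I : Ideal (𝓞 K) // I ≠ ⊥} =>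
      ((Ideal.absNorm I.1 : ℕ) : ℂ) ^ (-s)) (ζK s))
    {s : ℂ} (h1 : -1 < s.re) (h2 : s.re < 0) :
    gammaProd (InfinitePlace.nrRealPlaces K) (InfinitePlace.nrComplexPlaces K) s *
        (ζK (1 - s))⁻¹ =
      ((|(discr K : ℝ)| / archConst K : ℝ) : ℂ) ^ ((1 : ℂ) / 2 - s) *
        gammaProd (InfinitePlace.nrRealPlaces K) (InfinitePlace.nrComplexPlaces K) (1 - s) /
          ζK s := by
  have hG := gammaProd_ne_zero (InfinitePlace.nrRealPlaces K) (InfinitePlace.nrComplexPlaces K)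
    h1 h2
  have hG' := gammaProd_ne_zero_of_re_pos (InfinitePlace.nrRealPlaces K)
    (InfinitePlace.nrComplexPlaces K) (s := 1 - s) (by simp; linarith)
  have hs0 : s ≠ 0 := by rintro rfl; simp at h2
  have hs1 : s ≠ 1 := by rintro rfl; simp at h2; linarith
  have h := dedekindZeta_functional_equation hζ_an hζ_ser hs0 hs1 hG hG'
  have hD : ((|(discr K : ℝ)| / archConst K : ℝ) : ℂ) ≠ 0 := by
    exact_mod_cast (div_pos abs_discr_pos archConst_pos).ne'
  have hDs : ((|(discr K : ℝ)| / archConst K : ℝ) : ℂ) ^ (s - 1 / 2) ≠ 0 := by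
    rw [Ne, Complex.cpow_eq_zero_iff]
    exact fun h => hD h.1
  rw [show (1 : ℂ) / 2 - s = -(s - 1 / 2) by ring, Complex.cpow_neg]
  by_cases hz : ζK s = 0
  · have : ζK (1 - s) = 0 := by simpa [hz, hG'] using h
    simp [hz, this]
  · have hz' : ζK (1 - s) ≠ 0 := by
      intro h0
      simp [hz, h0, hG] at h
      exact hDs (by simp [h])
    rw [← div_eq_mul_inv, div_eq_div_iff hz' hz]
    rw [mul_assoc, inv_mul_eq_div, eq_div_iff hDs, ← h]
    ring

theorem mellinInv_eq_mul_integral (c : ℝ) (g : ℂ → ℂ) (x : ℝ) :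
    mellinInv c g x = ((1 / (2 * Real.pi) : ℝ) : ℂ) *
      ∫ y : ℝ, (x : ℂ) ^ (-(c + y * I : ℂ)) * g (c + y * I) := by
  rw [← Complex.real_smul]
  rfl

/-- Termwise integration of a Dirichlet series against an integrable kernel on a vertical line. -/
theorem hasSum_mellinInv_of_hasSum_dirichlet {a : ℕ → ℂ} {L g : ℂ → ℂ} {c α : ℝ} (hα : 0 < α)
    (hc : c < 0) (ha : ∀ s : ℂ, 1 < s.re → HasSum (fun m : ℕ => a m * (m : ℂ) ^ (-s)) (L s))
    (hg : MeasureTheory.Integrable fun y : ℝ => g (c + y * I)) :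
    HasSum (fun m : ℕ => a m / m * mellinInv c g (α / m))
      (mellinInv c (fun s => g s * L (1 - s)) α) := by
  have hα0 : (α : ℂ) ≠ 0 := by exact_mod_cast hα.ne'
  set F : ℕ → ℝ → ℂ := fun m y =>
    a m * (m : ℂ) ^ (-(1 - (c + y * I))) * ((α : ℂ) ^ (-(c + y * I)) * g (c + y * I)) with hF
  have hcont (z : ℂ) (hz : z ≠ 0) (w : ℝ → ℂ) (hw : Continuous w) :
      Continuous fun y => z ^ w y := hw.const_cpow (.inl hz)
  have hkey (m : ℕ) (y : ℝ) :
      ‖F m y‖ = ‖a m * (m : ℂ) ^ (-(1 - (c : ℂ)))‖ * (α ^ (-c) * ‖g (c + y * I)‖) := by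
    simp only [hF, norm_mul]
    rw [norm_cpow_eq_rpow_re_of_pos hα, norm_natCast_cpow_of_re_ne_zero _ (by simp; linarith),
      norm_natCast_cpow_of_re_ne_zero _ (by simp; linarith)]
    simp
  have h_int (m : ℕ) : MeasureTheory.Integrable (F m) := by
    refine ((hg.norm.const_mul (α ^ (-c))).const_mul ‖a m * (m : ℂ) ^ (-(1 - (c : ℂ)))‖).mono'
      ?_ (.of_forall fun y => (hkey m y).le)
    refine MeasureTheory.AEStronglyMeasurable.mul ?_ (MeasureTheory.AEStronglyMeasurable.mul
      (hcont _ hα0 _ (by fun_prop)).aestronglyMeasurable hg.aestronglyMeasurable)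
    rcases eq_or_ne m 0 with rfl | hm
    · have : (fun y : ℝ => a 0 * ((0 : ℕ) : ℂ) ^ (-(1 - (c + y * I : ℂ)))) = fun _ => 0 := by
        ext y
        rw [Nat.cast_zero, Complex.zero_cpow, mul_zero]
        intro h
        have := congrArg Complex.re h
        simp at this
        linarith
      rw [this]
      exact MeasureTheory.aestronglyMeasurable_const
    · exact ((hcont _ (Nat.cast_ne_zero.2 hm) _ (by fun_prop)).const_mul _).aestronglyMeasurable
  have hsum : Summable fun m => ∫ y, ‖F m y‖ := by
    simp only [hkey, MeasureTheory.integral_const_mul]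
    exact (ha (1 - c) (by simp; linarith)).summable.norm.mul_right _
  have h := (MeasureTheory.hasSum_integral_of_summable_integral_norm h_int hsum).mul_left
    ((1 / (2 * Real.pi) : ℝ) : ℂ)
  have hterm : (fun m : ℕ => a m / m * mellinInv c g (α / m)) =
      fun m => ((1 / (2 * Real.pi) : ℝ) : ℂ) * ∫ y, F m y := by
    ext m
    rw [mellinInv_eq_mul_integral, mul_left_comm]
    congr 1
    rw [← MeasureTheory.integral_const_mul]
    congr 1
    ext y
    rcases eq_or_ne m 0 with rfl | hm
    · simp only [hF, Nat.cast_zero, div_zero, zero_mul]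
      rw [Complex.zero_cpow, mul_zero, zero_mul]
      intro h
      have := congrArg Complex.re h
      simp at this
      linarith
    · have hm0 : (0 : ℝ) < m := by positivity
      have hmc : (m : ℂ) ≠ 0 := Nat.cast_ne_zero.2 hm
      have hdiv : ((α / m : ℝ) : ℂ) ^ (-(c + y * I : ℂ)) =
          (α : ℂ) ^ (-(c + y * I : ℂ)) * (m : ℂ) ^ (c + y * I : ℂ) := by
        have := Complex.mul_cpow_ofReal_nonneg (div_pos hα hm0).le hm0.le (-(c + y * I : ℂ))
        rw [← Complex.ofReal_mul, div_mul_cancel₀ _ hm0.ne', Complex.ofReal_natCast] at this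
        rw [this, mul_assoc, ← Complex.cpow_add _ _ hmc, neg_add_cancel, Complex.cpow_zero, mul_one]
      simp only [hF]
      rw [hdiv, neg_sub, Complex.cpow_sub _ _ hmc, Complex.cpow_one]
      ring
  rw [hterm, show mellinInv c (fun s => g s * L (1 - s)) α =
    ((1 / (2 * Real.pi) : ℝ) : ℂ) * ∫ y, ∑' m, F m y from ?_]
  · exact h
  · rw [mellinInv_eq_mul_integral]
    congr 2
    ext y
    have := (ha (1 - (c + y * I)) (by simp; linarith)).mul_right
      ((α : ℂ) ^ (-(c + y * I : ℂ)) * g (c + y * I))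
    rw [this.tsum_eq]
    ring

/-- Equation (3.10) of Dixit–Gupta–Vatwani: for `-1/2 < c < 0` and `α > 0`,
`∑_{m ≥ 1} (b_m/m) Z_{r₁,r₂}(α/m)
  = (1/(2πi)) ∫_{Re s = c} (|d_K|/(4^{r₂}π^n))^{1/2-s} α^{-s}
      Γ^{r₁}((1-s)/2) Γ^{r₂}(1-s)/ζ_K(s) ds`. -/
theorem sum_b_Z_eq_contour_integral
    (K : Type*) [Field K] [NumberField K] (ζK : ℂ → ℂ)
    (hζ_an : ∀ s : ℂ, s ≠ 1 → DifferentiableAt ℂ ζK s)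
    (hζ_ser : ∀ s : ℂ, 1 < s.re →
      HasSum (fun I : {I : Ideal (𝓞 K) // I ≠ ⊥} =>
        ((Ideal.absNorm I.1 : ℕ) : ℂ) ^ (-s)) (ζK s))
    (hζ_pole : ∃ A : ℂ, A ≠ 0 ∧
      Tendsto (fun s : ℂ => (s - 1) * ζK s) (𝓝[≠] (1 : ℂ)) (𝓝 A))
    (b : ℕ → ℝ)
    (hb : ∀ s : ℂ, 1 < s.re →
      HasSum (fun m : ℕ => (b m : ℂ) * (m : ℂ) ^ (-s)) (ζK s)⁻¹)
    (r₁ r₂ n : ℕ)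
    (hr₁ : r₁ = InfinitePlace.nrRealPlaces K)
    (hr₂ : r₂ = InfinitePlace.nrComplexPlaces K)
    (hn : n = Module.finrank ℚ K)
    (c : ℝ) (hc₁ : -(1/2) < c) (hc₂ : c < 0) (α : ℝ) (hα : 0 < α) :
    ∑' m : ℕ, ((b m : ℂ) / (m : ℂ)) * Z r₁ r₂ (α / m)
      = mellinInv c (fun s =>
          ((|(discr K : ℝ)| / (4 ^ r₂ * Real.pi ^ n) : ℝ) : ℂ) ^ ((1:ℂ)/2 - s) *
            (Complex.Gamma ((1 - s) / 2)) ^ r₁ * (Complex.Gamma (1 - s)) ^ r₂ /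
              ζK s) α := by
  subst hr₁ hr₂ hn
  have hr : InfinitePlace.nrRealPlaces K + InfinitePlace.nrComplexPlaces K ≠ 0 := by
    have h1 := InfinitePlace.card_add_two_mul_card_eq_rank K
    have h2 := Module.finrank_pos (R := ℚ) (M := K)
    omega
  have h_int : MeasureTheory.Integrable fun y : ℝ =>
      gammaProd (InfinitePlace.nrRealPlaces K) (InfinitePlace.nrComplexPlaces K) (c + y * I) := by
    refine integrable_of_norm_le_inv_one_add_sq (C := (4 / (-c) ^ 2) ^
      (InfinitePlace.nrRealPlaces K + InfinitePlace.nrComplexPlaces K)) ?_ fun y => ?_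
    · refine continuous_iff_continuousAt.2 fun y => ?_
      exact ContinuousAt.comp (g := gammaProd (InfinitePlace.nrRealPlaces K)
        (InfinitePlace.nrComplexPlaces K)) (f := fun y : ℝ => (c + y * I : ℂ))
        (differentiableAt_gammaProd _ _ (by simp; linarith) (by simpa using hc₂)).continuousAt
        (by fun_prop)
    · simpa using norm_gammaProd_le hr (s := c + y * I) (neg_pos.2 hc₂) (by simp; linarith)
        (by simp)
  have hsum := hasSum_mellinInv_of_hasSum_dirichlet hα hc₂ hb h_int
  have hterm (m : ℕ) : (b m : ℂ) / m *
      Z (InfinitePlace.nrRealPlaces K) (InfinitePlace.nrComplexPlaces K) (α / m) =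
      (b m : ℂ) / m * mellinInv c
        (gammaProd (InfinitePlace.nrRealPlaces K) (InfinitePlace.nrComplexPlaces K)) (α / m) := by
    rcases Nat.eq_zero_or_pos m with rfl | hm
    · rw [Nat.cast_zero, div_zero, zero_mul, zero_mul]
    · rw [Z_eq_mellinInv hr hc₁ hc₂ (div_pos hα (Nat.cast_pos.2 hm))]
  rw [tsum_congr hterm, hsum.tsum_eq, mellinInv_eq_mul_integral, mellinInv_eq_mul_integral]
  congr 2
  ext y
  rw [gammaProd_div_dedekindZeta_one_sub hζ_an hζ_ser (by simp; linarith) (by simpa using hc₂),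
    archConst, gammaProd]
  simp only [mul_assoc]
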